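/- Let A be a von Neumann algebra (viewed as a complex Banach space), let Y be a Banach space, and suppose T : A → Y is a bounded linear operator that fails to be weakly compact. Then there is a closed subspace E of A such that E is isomorphic (as a Banach space) to ℓ∞ and the restriction T|_E is an isomorphism onto its image. -/

import Mathlib

set_option synthInstance.maxHeartbeats 1000000
set_option maxHeartbeats 1000000

open NormedSpace

/-- An operator between normed spaces is weakly compact if the image of the closed unit ball
is relatively compact in the weak topology. -/
def IsWeaklyCompactOperator {E F : Type*} [NormedAddCommGroup E] [NormedSpace ℂ E]
    [NormedAddCommGroup F] [NormedSpace ℂ F] (T : E →L[ℂ] F) : Prop :=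
  IsCompact (closure (toWeakSpaceCLM ℂ F '' (T '' Metric.closedBall 0 1)))

open Filter Topology

section WeakCompactness

variable {E Y : Type*} [NormedAddCommGroup E] [NormedSpace ℂ E]
  [NormedAddCommGroup Y] [NormedSpace ℂ Y]

/-- A point of the weak-star closure in the bidual of the image of the unit ball is within `2 * ε`
of that image, provided `T` is `ε`-controlled by a quadratic form. -/
lemma exists_norm_sub_inclusionInDoubleDual_le {T : E →L[ℂ] Y} {q : E → ℝ} {B ε δ : ℝ}
    (hδ : 0 < δ) (hq : ∀ x, 0 ≤ q x) (hB : ∀ x, ‖x‖ ≤ 1 → q x ≤ B)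
    (hpar : ∀ x y, q ((1 / 2 : ℂ) • (x + y)) + q ((1 / 2 : ℂ) • (x - y)) = (q x + q y) / 2)
    (hT : ∀ x, ‖x‖ ≤ 1 → q x < δ → ‖T x‖ ≤ ε)
    (Ψ : StrongDual ℂ (StrongDual ℂ Y))
    (hΨ : ∀ (F : Finset (StrongDual ℂ Y)) (η : ℝ), 0 < η →
      ∃ x, ‖x‖ ≤ 1 ∧ ∀ f ∈ F, ‖f (T x) - Ψ f‖ ≤ η) :
    ∃ x, ‖Ψ - inclusionInDoubleDual ℂ Y (T x)‖ ≤ 2 * ε := by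
  classical
  have hε : 0 ≤ ε := by
    have h0 : q 0 = 0 := by
      have := hpar 0 0
      simp at this
      linarith
    exact (norm_nonneg _).trans (hT 0 (by simp) (by rwa [h0]))
  let V : Set ℝ := {r | ∃ (F : Finset (StrongDual ℂ Y)) (η : ℝ), 0 < η ∧
    ∀ x, ‖x‖ ≤ 1 → (∀ f ∈ F, ‖f (T x) - Ψ f‖ ≤ η) → r ≤ q x}
  have hV0 : (0 : ℝ) ∈ V := ⟨∅, 1, one_pos, fun x _ _ => hq x⟩
  have hVb : BddAbove V := by
    refine ⟨B, ?_⟩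
    rintro r ⟨F, η, hη, h⟩
    obtain ⟨x, hx, hx'⟩ := hΨ F η hη
    exact (h x hx hx').trans (hB x hx)
  obtain ⟨r, ⟨F₀, η₀, hη₀, hr⟩, hrd⟩ := exists_lt_of_lt_csSup ⟨0, hV0⟩
    (show sSup V - δ / 4 < sSup V by linarith)
  have hex : ∀ (F : Finset (StrongDual ℂ Y)) (η : ℝ), 0 < η →
      ∃ x, ‖x‖ ≤ 1 ∧ (∀ f ∈ F₀, ‖f (T x) - Ψ f‖ ≤ η₀) ∧ (∀ f ∈ F, ‖f (T x) - Ψ f‖ ≤ η) ∧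
        q x < sSup V + δ / 4 := by
    intro F η hη
    by_contra! hcon
    have : sSup V + δ / 4 ∈ V := by
      refine ⟨F₀ ∪ F, min η₀ η, lt_min hη₀ hη, fun x hx hx' => hcon x hx ?_ ?_⟩
      · exact fun f hf => (hx' f (Finset.mem_union_left _ hf)).trans (min_le_left _ _)
      · exact fun f hf => (hx' f (Finset.mem_union_right _ hf)).trans (min_le_right _ _)
    linarith [le_csSup hVb this]
  have hclose : ∀ x x' : E, ‖x‖ ≤ 1 → ‖x'‖ ≤ 1 → (∀ f ∈ F₀, ‖f (T x) - Ψ f‖ ≤ η₀) →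
      (∀ f ∈ F₀, ‖f (T x') - Ψ f‖ ≤ η₀) → q x < sSup V + δ / 4 → q x' < sSup V + δ / 4 →
      ‖T x - T x'‖ ≤ 2 * ε := by
    intro x x' hx hx' hf hf' hqx hqx'
    have hhalf : ∀ z : E, ‖(1 / 2 : ℂ) • z‖ = ‖z‖ / 2 := fun z => by
      rw [norm_smul]; norm_num; ring
    have hmid : r ≤ q ((1 / 2 : ℂ) • (x + x')) := by
      refine hr _ ?_ fun f hfF => ?_
      · rw [hhalf]; linarith [norm_add_le x x']
      · have : f (T ((1 / 2 : ℂ) • (x + x'))) - Ψ f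
            = (1 / 2 : ℂ) • ((f (T x) - Ψ f) + (f (T x') - Ψ f)) := by
          simp; ring
        rw [this, norm_smul]
        have h1 := hf f hfF
        have h2 := hf' f hfF
        have h3 := norm_add_le (f (T x) - Ψ f) (f (T x') - Ψ f)
        norm_num
        linarith
    have hsmall : q ((1 / 2 : ℂ) • (x - x')) < δ := by linarith [hpar x x']
    have := hT _ (by rw [hhalf]; linarith [norm_sub_le x x']) hsmall
    rw [map_smul, norm_smul, map_sub] at this
    norm_num at this
    linarith
  obtain ⟨x₀, hx₀, hF₀, -, hq₀⟩ := hex ∅ 1 one_pos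
  refine ⟨x₀, ContinuousLinearMap.opNorm_le_bound _ (by positivity) fun f => ?_⟩
  refine le_of_forall_pos_le_add fun η hη => ?_
  obtain ⟨x, hx, hF, hf, hqx⟩ := hex {f} η hη
  have h1 := hclose x x₀ hx hx₀ hF hF₀ hqx hq₀
  have h2 : ‖f (T x) - Ψ f‖ ≤ η := hf f (by simp)
  have h3 : ‖f (T x - T x₀)‖ ≤ 2 * ε * ‖f‖ := by
    calc _ ≤ ‖f‖ * ‖T x - T x₀‖ := f.le_opNorm _
      _ ≤ ‖f‖ * (2 * ε) := by gcongr
      _ = _ := by ring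
  have h4 : (Ψ - inclusionInDoubleDual ℂ Y (T x₀)) f
      = f (T x - T x₀) - (f (T x) - Ψ f) := by
    simp
  rw [h4]
  exact (norm_sub_le _ _).trans (add_le_add h3 h2)

theorem isWeaklyCompactOperator_of_quadratic_control [CompleteSpace Y] {T : E →L[ℂ] Y}
    (h : ∀ ε > 0, ∃ (q : E → ℝ) (B δ : ℝ), 0 < δ ∧ (∀ x, 0 ≤ q x) ∧ (∀ x, ‖x‖ ≤ 1 → q x ≤ B) ∧
      (∀ x y, q ((1 / 2 : ℂ) • (x + y)) + q ((1 / 2 : ℂ) • (x - y)) = (q x + q y) / 2) ∧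
      ∀ x, ‖x‖ ≤ 1 → q x < δ → ‖T x‖ ≤ ε) :
    IsWeaklyCompactOperator T := by
  refine NormedSpace.isCompact_closure_of_isBounded ℂ Y _ ?_ ?_
  · have : (toWeakSpace ℂ Y) ⁻¹' (toWeakSpaceCLM ℂ Y '' (T '' Metric.closedBall 0 1))
        = T '' Metric.closedBall 0 1 :=
      Set.preimage_image_eq _ (toWeakSpace ℂ Y).injective
    rw [this]
    exact T.lipschitz.isBounded_image Metric.isBounded_closedBall
  · intro Ψ' hΨ'
    set Ψ : StrongDual ℂ (StrongDual ℂ Y) := StrongDual.toWeakDual.symm Ψ' with hΨ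
    have happrox : ∀ (F : Finset (StrongDual ℂ Y)) (η : ℝ), 0 < η →
        ∃ x, ‖x‖ ≤ 1 ∧ ∀ f ∈ F, ‖f (T x) - Ψ f‖ ≤ η := by
      intro F η hη
      have hopen : IsOpen (⋂ f ∈ F, {Φ : WeakDual ℂ (StrongDual ℂ Y) | ‖Φ f - Ψ' f‖ < η}) := by
        refine isOpen_biInter_finset fun f _ => ?_
        exact isOpen_lt ((WeakDual.eval_continuous f).sub continuous_const).norm continuous_const
      obtain ⟨_, hΦ, _, ⟨_, ⟨x, hx, rfl⟩, rfl⟩, rfl⟩ :=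
        mem_closure_iff.1 hΨ' _ hopen (by simpa using fun f _ => hη)
      refine ⟨x, by simpa using hx, fun f hf => ?_⟩
      exact le_of_lt (Set.mem_iInter₂.1 hΦ f hf)
    have hcl : IsClosed (Set.range (inclusionInDoubleDual ℂ Y)) :=
      (inclusionInDoubleDualLi (E := Y) ℂ).isometry.isUniformInducing.isComplete_range.isClosed
    have hmem : Ψ ∈ Set.range (inclusionInDoubleDual ℂ Y) := by
      rw [← hcl.closure_eq]
      refine (Metric.mem_closure_iff (α := StrongDual ℂ (StrongDual ℂ Y))).2 ?_
      intro ε hε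
      obtain ⟨q, B, δ, hδ, hq, hB, hpar, hT⟩ := h (ε / 4) (by positivity)
      obtain ⟨x, hx⟩ := exists_norm_sub_inclusionInDoubleDual_le hδ hq hB hpar hT Ψ happrox
      exact ⟨_, ⟨T x, rfl⟩, (dist_eq_norm Ψ _).trans_lt (by linarith)⟩
    obtain ⟨y, hy⟩ := hmem
    exact ⟨toWeakSpace ℂ Y y, congrArg StrongDual.toWeakDual hy⟩

end WeakCompactness

section Cut

variable {A : Type*} [CStarAlgebra A] [PartialOrder A] [StarOrderedRing A]

lemma isUnit_one_add_of_nonneg {s : A} (hs : 0 ≤ s) : IsUnit (1 + s) :=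
  CStarAlgebra.isUnit_of_le 1 (le_add_of_nonneg_right hs)

/-- The element `(1 + s)⁻¹`, which for `0 ≤ s` cuts down to the part where `s` is small. -/
noncomputable def cutoff (s : A) : A := Ring.inverse (1 + s)

lemma cutoff_mul_one_add {s : A} (hs : 0 ≤ s) : cutoff s * (1 + s) = 1 :=
  Ring.inverse_mul_cancel _ (isUnit_one_add_of_nonneg hs)

lemma one_add_mul_cutoff {s : A} (hs : 0 ≤ s) : (1 + s) * cutoff s = 1 :=
  Ring.mul_inverse_cancel _ (isUnit_one_add_of_nonneg hs)

lemma isSelfAdjoint_cutoff {s : A} (hs : 0 ≤ s) : IsSelfAdjoint (cutoff s) := by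
  have h1 : IsSelfAdjoint (1 + s) := (IsSelfAdjoint.one A).add (.of_nonneg hs)
  have h2 := congrArg star (one_add_mul_cutoff hs)
  rw [star_mul, h1.star_eq, star_one] at h2
  calc star (cutoff s) = star (cutoff s) * ((1 + s) * cutoff s) := by
        rw [one_add_mul_cutoff hs, mul_one]
    _ = cutoff s := by rw [← mul_assoc, h2, one_mul]

lemma cutoff_nonneg {s : A} (hs : 0 ≤ s) : 0 ≤ cutoff s := by
  have h1 : cutoff s = star (cutoff s) * (1 + s) * cutoff s := by
    rw [(isSelfAdjoint_cutoff hs).star_eq, cutoff_mul_one_add hs, one_mul]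
  rw [h1]
  exact star_left_conjugate_nonneg (add_nonneg zero_le_one hs) _

lemma cutoff_mul_self_le {s : A} (hs : 0 ≤ s) : cutoff s * cutoff s ≤ cutoff s := by
  have h1 : cutoff s = cutoff s * cutoff s + star (cutoff s) * s * cutoff s := by
    rw [(isSelfAdjoint_cutoff hs).star_eq, ← add_mul]
    nth_rw 2 [← mul_one (cutoff s)]
    rw [← mul_add, cutoff_mul_one_add hs, one_mul]
  nth_rw 3 [h1]
  exact le_add_of_nonneg_right (star_left_conjugate_nonneg hs _)

lemma one_sub_cutoff {s : A} (hs : 0 ≤ s) : 1 - cutoff s = s * cutoff s := by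
  have := one_add_mul_cutoff hs
  rw [add_mul, one_mul] at this
  rw [← this]; abel

lemma one_sub_cutoff_nonneg {s : A} (hs : 0 ≤ s) : 0 ≤ 1 - cutoff s := by
  have h1 : star (1 - cutoff s) * (1 - cutoff s) + (cutoff s - cutoff s * cutoff s)
      = 1 - cutoff s := by
    rw [star_sub, star_one, (isSelfAdjoint_cutoff hs).star_eq]; noncomm_ring
  rw [← h1]
  exact add_nonneg (star_mul_self_nonneg _) (sub_nonneg.2 (cutoff_mul_self_le hs))

lemma norm_cutoff_le {s : A} (hs : 0 ≤ s) : ‖cutoff s‖ ≤ 1 :=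
  (CStarAlgebra.norm_le_one_iff_of_nonneg _ (cutoff_nonneg hs)).2
    (sub_nonneg.1 (one_sub_cutoff_nonneg hs))

lemma norm_one_sub_cutoff_le {s : A} (hs : 0 ≤ s) : ‖1 - cutoff s‖ ≤ 1 :=
  (CStarAlgebra.norm_le_one_iff_of_nonneg _ (one_sub_cutoff_nonneg hs)).2
    (sub_le_self _ (cutoff_nonneg hs))

lemma one_sub_cutoff_mul_self_le {s : A} (hs : 0 ≤ s) :
    (1 - cutoff s) * (1 - cutoff s) ≤ s := by
  have h1 : s = (1 - cutoff s) * (1 - cutoff s) + (cutoff s - cutoff s * cutoff s)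
      + star s * cutoff s * s := by
    have h2 : s * cutoff s * s = s - (1 - cutoff s) := by
      have := cutoff_mul_one_add hs
      rw [← one_sub_cutoff hs, sub_mul, one_mul]
      rw [mul_add, mul_one] at this
      rw [← this]; abel
    rw [(IsSelfAdjoint.of_nonneg hs).star_eq, h2]; noncomm_ring
  nth_rw 3 [h1]
  rw [add_assoc]
  exact le_add_of_nonneg_right (add_nonneg (sub_nonneg.2 (cutoff_mul_self_le hs))
    (star_left_conjugate_nonneg (cutoff_nonneg hs) _))

lemma star_mul_self_le_one {v : A} (hv : ‖v‖ ≤ 1) : star v * v ≤ 1 := by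
  refine (CStarAlgebra.norm_le_one_iff_of_nonneg _ (star_mul_self_nonneg v)).1 ?_
  rw [CStarRing.norm_star_mul_self]
  nlinarith [norm_nonneg v]

lemma cutoff_conjugate_le {s v : A} (hs : 0 ≤ s) (hv : ‖v‖ ≤ 1) :
    star (v * cutoff s) * (v * cutoff s) ≤ 2 • (cutoff s - cutoff (s + star v * v)) := by
  set q := cutoff s with hq
  have hs' : 0 ≤ s + star v * v := add_nonneg hs (star_mul_self_nonneg v)
  set q' := cutoff (s + star v * v) with hq'
  set c := v * q * star v with hc
  have hqs : star q = q := (isSelfAdjoint_cutoff hs).star_eq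
  have hqs' : star q' = q' := (isSelfAdjoint_cutoff hs').star_eq
  have hcs : star c = c := by simp [hc, hqs, mul_assoc]
  have hdiff : q - q' = q * (star v * v) * q' := by
    have e1 : q * (1 + s) = 1 := cutoff_mul_one_add hs
    have e2 : (1 + (s + star v * v)) * q' = 1 := one_add_mul_cutoff hs'
    calc q - q' = q * ((1 + (s + star v * v)) * q') - (q * (1 + s)) * q' := by
          rw [e1, e2, mul_one, one_mul]
      _ = _ := by noncomm_ring
  have hvq : v * q = (1 + c) * (v * q') := by
    calc v * q = v * q' + v * (q - q') := by noncomm_ring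
      _ = _ := by rw [hdiff, hc]; noncomm_ring
  have hc1 : ‖c‖ ≤ 1 := by
    have := norm_cutoff_le hs
    calc ‖c‖ ≤ ‖v‖ * ‖q‖ * ‖star v‖ := (norm_mul_le _ _).trans (by gcongr; exact norm_mul_le _ _)
      _ ≤ 1 * 1 * 1 := by rw [norm_star]; gcongr
      _ = 1 := by norm_num
  have hcc : c * c ≤ 1 := by simpa [hcs] using star_mul_self_le_one hc1
  have hl : star (v * q) * (v * q) = star (v * q') * ((1 + c) * (1 + c)) * (v * q') := by
    rw [hvq, star_mul, star_add, star_one, hcs]; noncomm_ring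
  have hr : q - q' = star (v * q') * (1 + c) * (v * q') := by
    have : q - q' = star (v * q) * (v * q') := by
      rw [hdiff, star_mul, hqs]; noncomm_ring
    rw [this, hvq, star_mul, star_add, star_one, hcs]
  rw [hl, hr]
  have key : (1 + c) * (1 + c) ≤ 2 • (1 + c) := by
    have : 2 • (1 + c) - (1 + c) * (1 + c) = 1 - c * c := by noncomm_ring
    rw [← sub_nonneg, this]; exact sub_nonneg.2 hcc
  calc _ ≤ star (v * q') * (2 • (1 + c)) * (v * q') := star_left_conjugate_le_conjugate key _
    _ = _ := by simp [two_smul, mul_add, add_mul]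

end Cut

section PositiveControl

variable {A Y : Type*} [CStarAlgebra A] [NormedAddCommGroup Y] [NormedSpace ℂ Y]

lemma star_half_smul_mul_self (z : A) :
    star ((1 / 2 : ℂ) • z) * ((1 / 2 : ℂ) • z) = (1 / 4 : ℝ) • (star z * z) := by
  rw [star_smul, smul_mul_smul_comm, ← Complex.coe_smul]
  congr 1
  simp
  norm_num

lemma half_smul_mul_star_self (z : A) :
    ((1 / 2 : ℂ) • z) * star ((1 / 2 : ℂ) • z) = (1 / 4 : ℝ) • (z * star z) := by
  rw [star_smul, smul_mul_smul_comm, ← Complex.coe_smul]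
  congr 1
  simp
  norm_num

variable [PartialOrder A] [StarOrderedRing A]

lemma monotone_of_nonneg_of_linear {φ : A →ₗ[ℝ] ℝ} (hφ : ∀ a, 0 ≤ a → 0 ≤ φ a) {a b : A}
    (hab : a ≤ b) : φ a ≤ φ b := by
  have := hφ _ (sub_nonneg.2 hab)
  rw [map_sub] at this
  linarith

lemma exists_norm_lt_of_not_isWeaklyCompactOperator [CompleteSpace Y] {T : A →L[ℂ] Y}
    (hT : ¬ IsWeaklyCompactOperator T) :
    ∃ ε > 0, ∀ φ : A →ₗ[ℝ] ℝ, (∀ a, 0 ≤ a → 0 ≤ φ a) → ∀ δ > 0,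
      ∃ x, ‖x‖ ≤ 1 ∧ φ (star x * x + x * star x) < δ ∧ ε < ‖T x‖ := by
  by_contra! hcon
  refine hT (isWeaklyCompactOperator_of_quadratic_control fun ε hε => ?_)
  obtain ⟨φ, hφ, δ, hδ, h⟩ := hcon ε hε
  refine ⟨fun x => φ (star x * x + x * star x), φ (1 + 1), δ, hδ, fun x => hφ _ ?_,
    fun x hx => monotone_of_nonneg_of_linear hφ (add_le_add (star_mul_self_le_one hx) ?_),
    fun x y => ?_, h⟩
  · exact add_nonneg (star_mul_self_nonneg x) (mul_star_self_nonneg x)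
  · simpa using star_mul_self_le_one (v := star x) (by simpa using hx)
  · simp only [star_half_smul_mul_self, half_smul_mul_star_self, ← smul_add, map_smul, smul_eq_mul]
    rw [← mul_add, ← map_add]
    have : star (x + y) * (x + y) + (x + y) * star (x + y)
        + (star (x - y) * (x - y) + (x - y) * star (x - y))
        = (2 : ℝ) • (star x * x + x * star x + (star y * y + y * star y)) := by
      rw [two_smul, star_add, star_sub]; noncomm_ring
    rw [this, map_smul, smul_eq_mul, map_add]
    ring

lemma exists_nonneg_norm_lt_of_not_isWeaklyCompactOperator [CompleteSpace Y] {T : A →L[ℂ] Y}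
    (hT : ¬ IsWeaklyCompactOperator T) :
    ∃ ε > 0, ∀ φ : A →ₗ[ℝ] ℝ, (∀ a, 0 ≤ a → 0 ≤ φ a) → ∀ δ > 0,
      ∃ a, 0 ≤ a ∧ ‖a‖ ≤ 1 ∧ φ a < δ ∧ ε < ‖T a‖ := by
  obtain ⟨ε, hε, h⟩ := exists_norm_lt_of_not_isWeaklyCompactOperator hT
  refine ⟨ε / 4, by positivity, fun φ hφ δ hδ => ?_⟩
  have hφ1 : 0 ≤ φ 1 := hφ 1 zero_le_one
  set κ := δ / (φ 1 + 1) with hκ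
  have hκ0 : 0 < κ := by positivity
  have hκδ : κ * φ 1 ≤ δ := by
    rw [hκ, div_mul_eq_mul_div, div_le_iff₀ (by positivity)]
    nlinarith
  obtain ⟨x, hx, hφx, hTx⟩ := h φ hφ (κ * δ) (by positivity)
  -- a self-adjoint contraction with small square
  obtain ⟨b, hb, hb1, hφb, hTb⟩ : ∃ b, IsSelfAdjoint b ∧ ‖b‖ ≤ 1 ∧ φ (b * b) < κ * δ ∧
      ε / 2 < ‖T b‖ := by
    have hre : ∀ z : A, ‖z‖ ≤ 1 → φ (star z * z + z * star z) < κ * δ →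
        IsSelfAdjoint (realPart z : A) ∧ ‖(realPart z : A)‖ ≤ 1 ∧
          φ ((realPart z : A) * realPart z) < κ * δ := by
      intro z hz hφz
      refine ⟨(realPart z).2, (realPart.norm_le z).trans hz, ?_⟩
      have hsq : (realPart z : A) * realPart z + (imaginaryPart z : A) * imaginaryPart z
          = (1 / 2 : ℝ) • (star z * z + z * star z) := by
        have h1 := star_mul_self_add_self_mul_star z
        rw [h1, ← Nat.cast_smul_eq_nsmul ℝ, smul_smul]
        norm_num
      have himag : 0 ≤ (imaginaryPart z : A) * imaginaryPart z := by
        have := star_mul_self_nonneg (imaginaryPart z : A)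
        rwa [(imaginaryPart z).2.star_eq] at this
      have h2 := congrArg φ hsq
      rw [map_add, map_smul, smul_eq_mul] at h2
      have h3 := hφ _ himag
      have h4 := hφ _ (add_nonneg (star_mul_self_nonneg z) (mul_star_self_nonneg z))
      linarith
    have hdec : T x = T (realPart x : A) + Complex.I • T (imaginaryPart x : A) := by
      conv_lhs => rw [← realPart_add_I_smul_imaginaryPart x]
      simp
    have hsum : ‖T x‖ ≤ ‖T (realPart x : A)‖ + ‖T (imaginaryPart x : A)‖ := by
      rw [hdec]
      refine (norm_add_le _ _).trans_eq ?_
      rw [norm_smul, Complex.norm_I, one_mul]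
    by_cases hlt : ε / 2 < ‖T (realPart x : A)‖
    · obtain ⟨h1, h2, h3⟩ := hre x hx hφx
      exact ⟨_, h1, h2, h3, hlt⟩
    · have hy := hre (Complex.I • x) (by simpa [norm_smul] using hx) (by
        rw [star_smul, smul_mul_smul_comm, smul_mul_smul_comm]
        simpa using hφx)
      rw [realPart_I_smul] at hy
      refine ⟨(imaginaryPart x : A), (imaginaryPart x).2, by simpa using hy.2.1,
        by simpa using hy.2.2, by linarith⟩
  obtain ⟨a, ha, ha1, hφa, hTa⟩ : ∃ a : A, 0 ≤ a ∧ ‖a‖ ≤ 1 ∧ φ (a * a) < κ * δ ∧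
      ε / 4 < ‖T a‖ := by
    have hpn : b⁺ - b⁻ = b := CFC.posPart_sub_negPart b hb
    have hsq : b * b = b⁺ * b⁺ + b⁻ * b⁻ := by
      have h1 : b⁺ * b⁻ = 0 := CFC.posPart_mul_negPart b
      have h2 : b⁻ * b⁺ = 0 := CFC.negPart_mul_posPart b
      nth_rw 1 2 [← hpn]
      rw [sub_mul, mul_sub, mul_sub, h1, h2]; abel
    have hnn : ∀ c : A, 0 ≤ c → 0 ≤ c * c := fun c hc => by
      simpa [(IsSelfAdjoint.of_nonneg hc).star_eq] using star_mul_self_nonneg c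
    have hp0 : 0 ≤ b⁺ := CFC.posPart_nonneg b
    have hn0 : 0 ≤ b⁻ := CFC.negPart_nonneg b
    have hφs := congrArg φ hsq
    rw [map_add] at hφs
    have hφp := hφ _ (hnn _ hp0)
    have hφn := hφ _ (hnn _ hn0)
    have hbb : b * b ≤ 1 := by
      simpa [hb.star_eq] using star_mul_self_le_one hb1
    have hnorm : ∀ c : A, 0 ≤ c → c * c ≤ b * b → ‖c‖ ≤ 1 := fun c hc hcb => by
      have h1 : ‖c * c‖ ≤ 1 :=
        (CStarAlgebra.norm_le_one_iff_of_nonneg _ (hnn c hc)).2 (hcb.trans hbb)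
      rw [(IsSelfAdjoint.of_nonneg hc).norm_mul_self] at h1
      nlinarith [norm_nonneg c]
    have hsum : ‖T b‖ ≤ ‖T b⁺‖ + ‖T b⁻‖ := by
      conv_lhs => rw [← hpn, map_sub]
      exact norm_sub_le _ _
    by_cases hlt : ε / 4 < ‖T b⁺‖
    · exact ⟨_, hp0, hnorm _ hp0 (by rw [hsq]; exact le_add_of_nonneg_right (hnn _ hn0)),
        by linarith, hlt⟩
    · exact ⟨_, hn0, hnorm _ hn0 (by rw [hsq]; exact le_add_of_nonneg_left (hnn _ hp0)),
        by linarith, by linarith⟩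
  refine ⟨a, ha, ha1, ?_, hTa⟩
  have hsq : 0 ≤ a * a - (2 * κ) • a + (κ ^ 2) • 1 := by
    have h1 := star_mul_self_nonneg (a - κ • (1 : A))
    have h2 : star (a - κ • (1 : A)) * (a - κ • (1 : A))
        = a * a - (2 * κ) • a + (κ ^ 2) • 1 := by
      rw [star_sub, star_smul, star_one, (IsSelfAdjoint.of_nonneg ha).star_eq, sub_mul, mul_sub,
        mul_sub, star_trivial, smul_mul_smul_comm, mul_smul_comm, smul_mul_assoc, mul_one, one_mul,
        mul_one, two_mul, add_smul, pow_two]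
      abel
    rwa [h2] at h1
  have h3 := hφ _ hsq
  rw [map_add, map_sub, map_smul, map_smul, smul_eq_mul, smul_eq_mul] at h3
  have h4 : κ * (κ * φ 1) ≤ κ * δ := by gcongr
  have h5 : 2 * κ * φ a < 2 * κ * δ := by nlinarith
  exact lt_of_mul_lt_mul_left h5 (by positivity)

lemma exists_factor_norm_lt_of_not_isWeaklyCompactOperator [CompleteSpace Y] {T : A →L[ℂ] Y}
    (hT : ¬ IsWeaklyCompactOperator T) :
    ∃ ε > 0, ∀ φ : A →ₗ[ℝ] ℝ, (∀ a, 0 ≤ a → 0 ≤ φ a) → ∀ δ > 0,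
      ∃ y z : A, ‖y‖ ≤ 1 ∧ ‖z‖ ≤ 1 ∧ φ (y * star y + star z * z) < δ ∧ ε < ‖T (y * z)‖ := by
  obtain ⟨ε, hε, h⟩ := exists_nonneg_norm_lt_of_not_isWeaklyCompactOperator hT
  refine ⟨ε, hε, fun φ hφ δ hδ => ?_⟩
  obtain ⟨a, ha, ha1, hφa, hTa⟩ := h φ hφ (δ / 2) (by positivity)
  have hs : CFC.sqrt a * CFC.sqrt a = a := CFC.sqrt_mul_sqrt_self a ha
  have hsa : IsSelfAdjoint (CFC.sqrt a) := .of_nonneg (CFC.sqrt_nonneg a)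
  have hn : ‖CFC.sqrt a‖ ≤ 1 := by
    have := hsa.norm_mul_self
    rw [hs] at this
    nlinarith [norm_nonneg (CFC.sqrt a)]
  refine ⟨CFC.sqrt a, CFC.sqrt a, hn, hn, ?_, by rwa [hs]⟩
  rw [hsa.star_eq, hs, map_add]
  linarith

end PositiveControl

section Domination

variable {A : Type*} [CStarAlgebra A] [PartialOrder A] [StarOrderedRing A]

lemma star_add_smul_mul_self_le {w y s : A} {M : ℝ} (hM : 0 < M) (c : ℝ)
    (hw : star w * w ≤ M • s) :
    star (w + c • y) * (w + c • y) ≤ (M + c ^ 2) • (s + star y * y) := by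
  have h1 : (M + c ^ 2) • (s + star y * y) - star (w + c • y) * (w + c • y)
      = (1 + c ^ 2 / M) • (M • s - star w * w)
        + M⁻¹ • (star (c • w - M • y) * (c • w - M • y)) := by
    simp only [star_add, star_sub, star_smul, star_trivial, add_mul, mul_add, sub_mul, mul_sub,
      mul_smul_comm, smul_mul_assoc, smul_add, smul_sub, smul_smul]
    match_scalars <;> field_simp <;> ring
  rw [← sub_nonneg, h1]
  exact add_nonneg (smul_nonneg (by positivity) (sub_nonneg.2 hw))
    (smul_nonneg (by positivity) (star_mul_self_nonneg _))

/-- The weighted sum `∑ μ y • y` over a list satisfies a Cauchy-Schwarz inequality. -/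
lemma star_list_sum_smul_mul_self_le (μ : A → ℝ) {M : ℝ} (hM : 0 < M) (L : List A) :
    star (L.map fun y => μ y • y).sum * (L.map fun y => μ y • y).sum ≤
      (M + (L.map fun y => μ y ^ 2).sum) • (L.map fun y => star y * y).sum := by
  induction L with
  | nil => simp
  | cons y L ih =>
    have h0 : 0 ≤ (L.map fun y => μ y ^ 2).sum :=
      List.sum_nonneg (by simpa using fun y _ => sq_nonneg (μ y))
    have := star_add_smul_mul_self_le (y := y) (by positivity) (μ y) ih
    simp only [List.map_cons, List.sum_cons]
    rw [add_comm (μ y • y), add_comm (μ y ^ 2), add_comm (star y * y), ← add_assoc]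
    exact this

lemma list_sum_sq_le {μ : A →ₗ[ℝ] ℝ} {C : ℝ} (hμ : ∀ y, |μ y| ≤ C * ‖y‖) (L : List A) :
    (L.map fun y => μ y ^ 2).sum ≤ C ^ 2 * ‖(L.map fun y => star y * y).sum‖ := by
  set w := (L.map fun y => μ y • y).sum with hw
  set m := (L.map fun y => μ y ^ 2).sum with hm
  set s := (L.map fun y => star y * y).sum with hs
  have hm0 : 0 ≤ m := List.sum_nonneg (by simpa using fun y _ => sq_nonneg (μ y))
  have hμw : μ w = m := by
    rw [hw, map_list_sum, List.map_map, hm]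
    congr 1
    refine List.map_congr_left fun y _ => ?_
    simp [pow_two]
  have hkey : ∀ M : ℝ, 0 < M → m ^ 2 ≤ C ^ 2 * ‖s‖ * m + M * (C ^ 2 * ‖s‖) := by
    intro M hM
    have h1 : ‖w‖ ^ 2 ≤ (M + m) * ‖s‖ := by
      have := CStarAlgebra.norm_le_norm_of_nonneg_of_le (star_mul_self_nonneg w)
        (star_list_sum_smul_mul_self_le μ hM L)
      rw [CStarRing.norm_star_mul_self, norm_smul, Real.norm_of_nonneg (by positivity)] at this
      rwa [pow_two]
    have h2 : m ^ 2 ≤ (C * ‖w‖) ^ 2 := by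
      rw [← hμw]
      exact sq_le_sq.2 ((hμ w).trans (le_abs_self _))
    nlinarith [mul_le_mul_of_nonneg_left h1 (sq_nonneg C)]
  have hlim : m ^ 2 ≤ C ^ 2 * ‖s‖ * m := by
    refine le_of_forall_pos_le_add fun η hη => ?_
    have h0 : 0 ≤ C ^ 2 * ‖s‖ := by positivity
    refine (hkey (η / (C ^ 2 * ‖s‖ + 1)) (by positivity)).trans ?_
    gcongr
    rw [div_mul_eq_mul_div, div_le_iff₀ (by positivity)]
    nlinarith
  rcases hm0.eq_or_lt with h | h
  · rw [← h]; positivity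
  · exact le_of_mul_le_mul_right (by rwa [← pow_two]) h

/-- Every bounded real functional on a C⋆-algebra is dominated, in the `L²` sense, by a positive
functional. -/
theorem exists_positive_dominating {μ : A →ₗ[ℝ] ℝ} {C : ℝ} (hμ : ∀ y, |μ y| ≤ C * ‖y‖) :
    ∃ φ : A →ₗ[ℝ] ℝ, (∀ a, 0 ≤ a → 0 ≤ φ a) ∧ ∀ y, μ y ^ 2 ≤ φ (star y * y) := by
  let s : List A → A := fun L => (L.map fun y => star y * y).sum
  let m : List A → ℝ := fun L => (L.map fun y => μ y ^ 2).sum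
  have hms : ∀ L, m L ≤ C ^ 2 * ‖s L‖ := fun L => list_sum_sq_le hμ L
  let N : A → ℝ := fun a => ⨅ L : List A, (C ^ 2 * ‖a + s L‖ - m L)
  have hbdd : ∀ a, BddBelow (Set.range fun L : List A => C ^ 2 * ‖a + s L‖ - m L) := by
    intro a
    refine ⟨-(C ^ 2 * ‖a‖), ?_⟩
    rintro _ ⟨L, rfl⟩
    have h1 : ‖s L‖ ≤ ‖a + s L‖ + ‖a‖ := by
      simpa using norm_sub_le (a + s L) a
    have h2 := mul_le_mul_of_nonneg_left h1 (sq_nonneg C)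
    have := hms L
    simp only
    linarith
  have hN_le : ∀ a L, N a ≤ C ^ 2 * ‖a + s L‖ - m L := fun a L => ciInf_le (hbdd a) L
  have hN_smul_le : ∀ c : ℝ, 0 < c → ∀ a, N (c • a) ≤ c * N a := by
    intro c hc a
    have hcs : √c * √c = c := Real.mul_self_sqrt hc.le
    rw [show c * N a = ⨅ L : List A, c * (C ^ 2 * ‖a + s L‖ - m L) from
      Real.mul_iInf_of_nonneg hc.le _]
    refine le_ciInf fun L => (hN_le _ (L.map fun y => √c • y)).trans_eq ?_
    have h1 : s (L.map fun y => √c • y) = c • s L := by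
      simp only [s, List.map_map, List.smul_sum]
      congr 1
      refine List.map_congr_left fun y _ => ?_
      simp [smul_smul, hcs]
    have h2 : m (L.map fun y => √c • y) = c * m L := by
      simp only [m, List.map_map, ← List.sum_map_mul_left]
      congr 1
      refine List.map_congr_left fun y _ => ?_
      simp [mul_pow, Real.sq_sqrt hc.le]
    rw [h1, h2, ← smul_add, norm_smul, Real.norm_of_nonneg hc.le]
    ring
  have hN_smul : ∀ c : ℝ, 0 < c → ∀ a, N (c • a) = c * N a := by
    intro c hc a
    refine le_antisymm (hN_smul_le c hc a) ?_
    have := hN_smul_le c⁻¹ (by positivity) (c • a)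
    rw [smul_smul, inv_mul_cancel₀ hc.ne', one_smul] at this
    calc c * N a ≤ c * (c⁻¹ * N (c • a)) := by gcongr
      _ = _ := by rw [← mul_assoc, mul_inv_cancel₀ hc.ne', one_mul]
  have hN_add : ∀ a b, N (a + b) ≤ N a + N b := by
    intro a b
    refine le_ciInf_add_ciInf fun L L' => (hN_le _ (L ++ L')).trans ?_
    have h1 : s (L ++ L') = s L + s L' := by simp [s]
    have h2 : m (L ++ L') = m L + m L' := by simp [m]
    have h3 : ‖a + b + (s L + s L')‖ ≤ ‖a + s L‖ + ‖b + s L'‖ := by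
      rw [add_add_add_comm]; exact norm_add_le _ _
    have h4 := mul_le_mul_of_nonneg_left h3 (sq_nonneg C)
    rw [h1, h2]
    linarith
  have hN0 : N 0 = 0 := by
    have := hN_smul 2 two_pos 0
    rw [smul_zero] at this
    linarith
  obtain ⟨φ, -, hφ⟩ := exists_extension_of_le_sublinear (⊥ : A →ₗ.[ℝ] ℝ) N hN_smul hN_add (by
    rintro ⟨x, hx⟩
    obtain rfl : x = 0 := (Submodule.mem_bot ℝ).1 hx
    rw [hN0]
    exact (map_zero (⊥ : A →ₗ.[ℝ] ℝ).toFun).le)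
  have hdom : ∀ y, μ y ^ 2 ≤ φ (star y * y) := by
    intro y
    have h1 := (hφ (-(star y * y))).trans (hN_le _ [y])
    simp only [map_neg, s, m, List.map_cons, List.map_nil, List.sum_cons, List.sum_nil, add_zero,
      neg_add_cancel, norm_zero, mul_zero, zero_sub] at h1
    linarith
  refine ⟨φ, fun a ha => ?_, hdom⟩
  have := hdom (CFC.sqrt a)
  rw [(IsSelfAdjoint.of_nonneg (CFC.sqrt_nonneg a)).star_eq, CFC.sqrt_mul_sqrt_self a ha] at this
  exact (sq_nonneg _).trans this

/-- A functional norming `T` at a given point, together with a positive functional dominating it. -/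
lemma exists_norming_and_positive_dominating {Y : Type*} [NormedAddCommGroup Y] [NormedSpace ℝ Y]
    (T : A →L[ℝ] Y) (x : A) :
    ∃ μ φ : A →ₗ[ℝ] ℝ, (∀ a, |μ a| ≤ ‖T a‖) ∧ μ x = ‖T x‖ ∧ (∀ a, 0 ≤ a → 0 ≤ φ a) ∧
      ∀ y, μ y ^ 2 ≤ φ (star y * y) := by
  obtain ⟨f, hf, hfx⟩ := exists_dual_vector'' ℝ (T x)
  have hle : ∀ a, |f (T a)| ≤ ‖T a‖ := fun a => by
    simpa using (f.le_opNorm (T a)).trans (mul_le_of_le_one_left (norm_nonneg _) hf)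
  obtain ⟨φ, hφ, hdom⟩ := exists_positive_dominating (μ := (f ∘L T : A →L[ℝ] ℝ).toLinearMap)
    (C := ‖T‖) fun y => (hle y).trans (T.le_opNorm y)
  exact ⟨_, φ, hle, by simpa using hfx, hφ, hdom⟩

end Domination

section Selection

lemma norm_mul_le_one {A : Type*} [NormedRing A] {a b : A} (ha : ‖a‖ ≤ 1) (hb : ‖b‖ ≤ 1) :
    ‖a * b‖ ≤ 1 :=
  (norm_mul_le a b).trans (mul_le_one₀ ha (norm_nonneg b) hb)

variable {A Y ι : Type*} [CStarAlgebra A] [PartialOrder A] [StarOrderedRing A]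
  [NormedAddCommGroup Y] [NormedSpace ℝ Y]

lemma star_mul_mul_self_le {u : A} (hu : ‖u‖ ≤ 1) (z : A) :
    star (u * z) * (u * z) ≤ star z * z := by
  have := star_left_conjugate_le_conjugate (star_mul_self_le_one hu) z
  rw [mul_one] at this
  rwa [star_mul, mul_assoc, ← mul_assoc (star u), ← mul_assoc (star z)]

lemma exists_selection_of_frequently {l : Filter ι} {T : A →L[ℝ] Y}
    {u v : ι → A} (hv : ∀ i, ‖v i‖ ≤ 1) {φ : A →ₗ[ℝ] ℝ}
    {S : Set A} (hS0 : 0 ∈ S) (hSadd : ∀ s ∈ S, ∀ i, s + star (v i) * v i ∈ S)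
    (hSnonneg : ∀ s ∈ S, 0 ≤ s) {w : A} (hw : ‖w‖ ≤ 1)
    (hlim : Tendsto (fun i => φ (star w * (star (v i) * v i) * w)) l (𝓝 0))
    {θ δ : ℝ} (hδ : 0 < δ)
    (h : ∀ s ∈ S, φ (star w * s * w) < δ →
      ∃ᶠ i in l, θ < ‖T (u i * (v i * (cutoff s * w)))‖) :
    ∃ Good : List A → Prop, Good [] ∧
      (∀ L, Good L → (L.map fun z => star z * z).sum ≤ 2 • 1) ∧
      ∀ L, Good L → ∀ E ∈ l, ∃ i ∈ E, ∃ g, ‖g‖ ≤ 1 ∧ θ < ‖T (u i * (v i * g))‖ ∧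
        Good (v i * g :: L) := by
  refine ⟨fun L => ∃ s ∈ S, φ (star w * s * w) < δ ∧
    (L.map fun z => star z * z).sum ≤ 2 • (star w * (1 - cutoff s) * w), ?_, ?_, ?_⟩
  · refine ⟨0, hS0, by simpa using hδ, ?_⟩
    simpa using nsmul_nonneg
      (star_left_conjugate_nonneg (one_sub_cutoff_nonneg (le_refl (0 : A))) w) 2
  · rintro L ⟨s, hs, -, hL⟩
    refine hL.trans (nsmul_le_nsmul_right ?_ 2)
    calc star w * (1 - cutoff s) * w ≤ star w * 1 * w :=
          star_left_conjugate_le_conjugate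
            (sub_le_self _ (cutoff_nonneg (hSnonneg s hs))) w
      _ ≤ 1 := by rw [mul_one]; exact star_mul_self_le_one hw
  · rintro L ⟨s, hs, hφs, hL⟩ E hE
    have hs0 := hSnonneg s hs
    have hsmall : ∀ᶠ i in l, φ (star w * (star (v i) * v i) * w) < δ - φ (star w * s * w) :=
      hlim.eventually_lt_const (by linarith)
    obtain ⟨i, hi, hi', hiE⟩ := ((h s hs hφs).and_eventually (hsmall.and hE)).exists
    refine ⟨i, hiE, cutoff s * w, norm_mul_le_one (norm_cutoff_le hs0) hw, hi,
      s + star (v i) * v i, hSadd s hs i, ?_, ?_⟩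
    · rw [mul_add, add_mul, map_add]; linarith
    · have h1 := star_left_conjugate_le_conjugate (cutoff_conjugate_le hs0 (hv i)) w
      have h2 : star (v i * (cutoff s * w)) * (v i * (cutoff s * w))
          = star w * (star (v i * cutoff s) * (v i * cutoff s)) * w := by
        simp only [star_mul, mul_assoc]
      rw [List.map_cons, List.sum_cons, h2]
      refine (add_le_add h1 hL).trans_eq ?_
      rw [mul_smul_comm, smul_mul_assoc, ← smul_add, ← add_mul, ← mul_add]
      congr 4
      abel

lemma exists_selection_of_eventually {l : Filter ι} [l.NeBot] {T : A →L[ℝ] Y}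
    {u v : ι → A} (hu : ∀ i, ‖u i‖ ≤ 1) (hv : ∀ i, ‖v i‖ ≤ 1) {ε : ℝ} (hε : 0 < ε)
    {μ φ : ι → A →ₗ[ℝ] ℝ} (hμT : ∀ i a, |μ i a| ≤ ‖T a‖) (hμ : ∀ i, ε ≤ μ i (u i * v i))
    (hφ : ∀ i a, 0 ≤ a → 0 ≤ φ i a) (hdom : ∀ i y, μ i y ^ 2 ≤ φ i (star y * y))
    {S : Set A} (hSnonneg : ∀ s ∈ S, 0 ≤ s) {W : Set A} (hW1 : 1 ∈ W) (hW : ∀ w ∈ W, ‖w‖ ≤ 1)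
    (hWS : ∀ w ∈ W, ∀ s ∈ S, (1 - cutoff s) * w ∈ W)
    (h : ∀ w ∈ W, ∀ θ > 0, ∀ k, ∀ δ > 0, ∃ s ∈ S, φ k (star w * s * w) < δ ∧
      ∀ᶠ i in l, ‖T (u i * (v i * (cutoff s * w)))‖ ≤ θ) :
    ∃ Good : List A → Prop, Good [] ∧
      (∀ L, Good L → (L.map fun z => star z * z).sum ≤ 2 • 1) ∧
      ∀ L, Good L → ∀ E ∈ l, ∃ i ∈ E, ∃ g, ‖g‖ ≤ 1 ∧ ε / 8 < ‖T (u i * (v i * g))‖ ∧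
        Good (v i * g :: L) := by
  refine ⟨fun L => ∃ w ∈ W, ∃ κ < ε / 2, (∀ᶠ i in l, ‖T (u i * (v i * (1 - w)))‖ ≤ κ) ∧
    (L.map fun z => star z * z).sum + star w * w ≤ 1, ?_, ?_, ?_⟩
  · exact ⟨1, hW1, 0, by positivity, by simp, by simp⟩
  · rintro L ⟨w, -, κ, -, -, hL⟩
    refine (le_add_of_nonneg_right (star_mul_self_nonneg w)).trans (hL.trans ?_)
    rw [two_smul]
    exact le_add_of_nonneg_right zero_le_one
  · rintro L ⟨w, hw, κ, hκ, hev, hL⟩ E hE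
    obtain ⟨i, hiκ, hiE⟩ := (hev.and hE).exists
    obtain ⟨s, hs, hφs, hsev⟩ := h w hw ((ε / 2 - κ) / 2) (by linarith) i ((ε / 4) ^ 2)
      (by positivity)
    have hs0 := hSnonneg s hs
    set q := cutoff s with hq
    have hqs : star q = q := (isSelfAdjoint_cutoff hs0).star_eq
    refine ⟨i, hiE, q * w, norm_mul_le_one (norm_cutoff_le hs0) (hW w hw), ?_,
      (1 - q) * w, hWS w hw s hs, κ + (ε / 2 - κ) / 2, by linarith, ?_, ?_⟩
    · have h1 : u i * (v i * (q * w)) = u i * v i - u i * (v i * (1 - w))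
          - u i * v i * ((1 - q) * w) := by noncomm_ring
      have h2 : μ i (u i * (v i * (1 - w))) ≤ κ :=
        (le_abs_self _).trans ((hμT i _).trans hiκ)
      have h3 : μ i (u i * v i * ((1 - q) * w)) < ε / 4 := by
        refine lt_of_pow_lt_pow_left₀ 2 (by positivity) ?_
        refine (hdom i _).trans_lt (lt_of_le_of_lt (monotone_of_nonneg_of_linear (hφ i) ?_) hφs)
        refine (star_mul_mul_self_le (norm_mul_le_one (hu i) (hv i)) _).trans ?_
        have h4 : star ((1 - q) * w) * ((1 - q) * w) = star w * ((1 - q) * (1 - q)) * w := by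
          simp only [star_mul, star_sub, star_one, hqs, mul_assoc]
        rw [h4]
        exact star_left_conjugate_le_conjugate (one_sub_cutoff_mul_self_le hs0) w
      have h5 := (le_abs_self _).trans (hμT i (u i * (v i * (q * w))))
      rw [h1, map_sub, map_sub, ← h1] at h5
      linarith [hμ i]
    · filter_upwards [hev, hsev] with j hj hj'
      have h1 : u j * (v j * (1 - (1 - q) * w)) = u j * (v j * (1 - w)) + u j * (v j * (q * w)) := by
        noncomm_ring
      rw [h1, map_add]
      exact (norm_add_le _ _).trans (add_le_add hj hj')
    · have h1 : star ((1 - q) * w) * ((1 - q) * w) = star w * ((1 - q) * (1 - q)) * w := by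
        simp only [star_mul, star_sub, star_one, hqs, mul_assoc]
      have h2 : star (v i * (q * w)) * (v i * (q * w)) ≤ star w * (q * q) * w := by
        refine (star_mul_mul_self_le (hv i) _).trans_eq ?_
        simp only [star_mul, hqs, mul_assoc]
      have h3 : star w * (q * q) * w + star w * ((1 - q) * (1 - q)) * w ≤ star w * w := by
        rw [← add_mul, ← mul_add]
        have h4 : q * q + (1 - q) * (1 - q) ≤ 1 := by
          have h5 : 1 - (q * q + (1 - q) * (1 - q)) = (q - q * q) + (q - q * q) := by noncomm_ring
          rw [← sub_nonneg, h5]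
          have := sub_nonneg.2 (cutoff_mul_self_le hs0)
          exact add_nonneg this this
        simpa using star_left_conjugate_le_conjugate h4 w
      rw [List.map_cons, List.sum_cons, h1]
      calc _ ≤ star w * (q * q) * w + (L.map fun z => star z * z).sum
            + star w * ((1 - q) * (1 - q)) * w := by gcongr
        _ = (L.map fun z => star z * z).sum
            + (star w * (q * q) * w + star w * ((1 - q) * (1 - q)) * w) := by abel
        _ ≤ (L.map fun z => star z * z).sum + star w * w := by gcongr
        _ ≤ 1 := hL

/-- From factored elements `u i * v i` on which `T` is large one may select, one after the other and
frequently along `l`, modifications `v i * g` whose squares add up to a bounded element. -/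
theorem exists_selection {l : Filter ι} [l.NeBot] {T : A →L[ℝ] Y}
    {u v : ι → A} (hu : ∀ i, ‖u i‖ ≤ 1) (hv : ∀ i, ‖v i‖ ≤ 1) {ε : ℝ} (hε : 0 < ε)
    {μ φ : ι → A →ₗ[ℝ] ℝ} (hμT : ∀ i a, |μ i a| ≤ ‖T a‖) (hμ : ∀ i, ε ≤ μ i (u i * v i))
    (hφ : ∀ i a, 0 ≤ a → 0 ≤ φ i a) (hdom : ∀ i y, μ i y ^ 2 ≤ φ i (star y * y))
    {S : Set A} (hS0 : 0 ∈ S) (hSadd : ∀ s ∈ S, ∀ i, s + star (v i) * v i ∈ S)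
    (hSnonneg : ∀ s ∈ S, 0 ≤ s) {W : Set A} (hW1 : 1 ∈ W) (hW : ∀ w ∈ W, ‖w‖ ≤ 1)
    (hWS : ∀ w ∈ W, ∀ s ∈ S, (1 - cutoff s) * w ∈ W)
    (hlim : ∀ w ∈ W, ∀ k, Tendsto (fun i => φ k (star w * (star (v i) * v i) * w)) l (𝓝 0)) :
    ∃ θ > 0, ∃ Good : List A → Prop, Good [] ∧
      (∀ L, Good L → (L.map fun z => star z * z).sum ≤ 2 • 1) ∧
      ∀ L, Good L → ∀ E ∈ l, ∃ i ∈ E, ∃ g, ‖g‖ ≤ 1 ∧ θ < ‖T (u i * (v i * g))‖ ∧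
        Good (v i * g :: L) := by
  by_cases h : ∀ w ∈ W, ∀ θ > 0, ∀ k, ∀ δ > 0, ∃ s ∈ S, φ k (star w * s * w) < δ ∧
      ∀ᶠ i in l, ‖T (u i * (v i * (cutoff s * w)))‖ ≤ θ
  · exact ⟨ε / 8, by positivity,
      exists_selection_of_eventually hu hv hε hμT hμ hφ hdom hSnonneg hW1 hW hWS h⟩
  · push Not at h
    obtain ⟨w, hw, θ, hθ, k, δ, hδ, h⟩ := h
    exact ⟨θ, hθ, exists_selection_of_frequently hv hS0 hSadd hSnonneg (hW w hw)
      (hlim w hw k) hδ fun s hs hφs => by simpa using h s hs hφs⟩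

end Selection

section LeftStage

variable {A Y ι : Type*} [CStarAlgebra A] [PartialOrder A]
  [NormedAddCommGroup Y] [NormedSpace ℂ Y]

lemma exists_filter_tendsto_zero {a : ι → A} (ha : ∀ i, 0 ≤ a i)
    (h : ∀ φ : A →ₗ[ℝ] ℝ, (∀ a, 0 ≤ a → 0 ≤ φ a) → ∀ δ > 0, ∃ i, φ (a i) < δ) :
    ∃ l : Filter ι, l.NeBot ∧ ∀ φ : A →ₗ[ℝ] ℝ, (∀ a, 0 ≤ a → 0 ≤ φ a) →
      Tendsto (fun i => φ (a i)) l (𝓝 0) := by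
  let l : Filter ι :=
    { sets := {E | ∃ φ : A →ₗ[ℝ] ℝ, (∀ a, 0 ≤ a → 0 ≤ φ a) ∧ ∃ δ > 0, ∀ i, φ (a i) < δ → i ∈ E}
      univ_sets := ⟨0, by simp, 1, one_pos, by simp⟩
      sets_of_superset := by
        rintro E E' ⟨φ, hφ, δ, hδ, h⟩ hE
        exact ⟨φ, hφ, δ, hδ, fun i hi => hE (h i hi)⟩
      inter_sets := by
        rintro E E' ⟨φ, hφ, δ, hδ, h⟩ ⟨φ', hφ', δ', hδ', h'⟩
        refine ⟨φ + φ', fun a ha => add_nonneg (hφ a ha) (hφ' a ha), min δ δ', lt_min hδ hδ',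
          fun i hi => ⟨h i ?_, h' i ?_⟩⟩
        · have := hφ' _ (ha i)
          rw [LinearMap.add_apply] at hi
          linarith [min_le_left δ δ']
        · have := hφ _ (ha i)
          rw [LinearMap.add_apply] at hi
          linarith [min_le_right δ δ'] }
  refine ⟨l, ⟨fun hbot => ?_⟩, fun φ hφ => ?_⟩
  · have hmem : ∅ ∈ l := by rw [hbot]; exact mem_bot
    obtain ⟨φ, hφ, δ, hδ, hE⟩ := hmem
    obtain ⟨i, hi⟩ := h φ hφ δ hδ
    exact hE i hi
  · refine Metric.tendsto_nhds.2 fun δ hδ => ?_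
    refine ⟨φ, hφ, δ, hδ, fun i hi => ?_⟩
    rw [Set.mem_ofPred_eq, Real.dist_0_eq_abs, abs_of_nonneg (hφ _ (ha i))]
    exact hi

variable [StarOrderedRing A]

/-- The positive functional `a ↦ φ (star w * a * w)`. -/
noncomputable def conjFunctional (φ : A →ₗ[ℝ] ℝ) (w : A) : A →ₗ[ℝ] ℝ :=
  φ ∘ₗ LinearMap.mulRight ℝ w ∘ₗ LinearMap.mulLeft ℝ (star w)

lemma tendsto_conj_zero {l : Filter ι} {a b : ι → A} (ha : ∀ i, 0 ≤ a i) (hab : ∀ i, a i ≤ b i)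
    (h : ∀ φ : A →ₗ[ℝ] ℝ, (∀ a, 0 ≤ a → 0 ≤ φ a) → Tendsto (fun i => φ (b i)) l (𝓝 0))
    {φ : A →ₗ[ℝ] ℝ} (hφ : ∀ a, 0 ≤ a → 0 ≤ φ a) (w : A) :
    Tendsto (fun i => φ (star w * a i * w)) l (𝓝 0) := by
  refine squeeze_zero (fun i => hφ _ (star_left_conjugate_nonneg (ha i) w)) (fun i => ?_)
    (h (conjFunctional φ w) fun a ha => hφ _ (star_left_conjugate_nonneg ha w))
  exact monotone_of_nonneg_of_linear hφ (star_left_conjugate_le_conjugate (hab i) w)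

/-- Selection on the left: the left factors `y i` are modified into `u` whose squares `u * star u`
add up to a bounded element. -/
lemma exists_left_selection {l : Filter ι} [l.NeBot] (T : A →L[ℂ] Y)
    {y z : ι → A} (hy : ∀ i, ‖y i‖ ≤ 1) (hz : ∀ i, ‖z i‖ ≤ 1) {ε : ℝ} (hε : 0 < ε)
    (hT : ∀ i, ε ≤ ‖T (y i * z i)‖)
    (hlim : ∀ φ : A →ₗ[ℝ] ℝ, (∀ a, 0 ≤ a → 0 ≤ φ a) → ∀ w,
      Tendsto (fun i => φ (star w * (y i * star (y i)) * w)) l (𝓝 0)) :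
    ∃ θ > 0, ∃ Good : List A → Prop, Good [] ∧
      (∀ L, Good L → (L.map fun u => u * star u).sum ≤ 2 • 1) ∧
      ∀ L, Good L → ∀ E ∈ l, ∃ i ∈ E, ∃ u, ‖u‖ ≤ 1 ∧ θ < ‖T (u * z i)‖ ∧ Good (u :: L) := by
  let T' : A →L[ℝ] Y := T.restrictScalars ℝ ∘L (starL' ℝ : A ≃L[ℝ] A).toContinuousLinearMap
  have hT' : ∀ a, T' a = T (star a) := fun a => rfl
  choose μ φ hμT hμ hφ hdom using exists_norming_and_positive_dominating T'
  obtain ⟨θ, hθ, Good, h0, h2, hstep⟩ := exists_selection (l := l) (T := T')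
    (u := fun i => star (z i)) (v := fun i => star (y i)) (by simpa using hz) (by simpa using hy) hε
    (μ := fun i => μ (star (z i) * star (y i))) (φ := fun i => φ (star (z i) * star (y i)))
    (fun i => hμT _) (fun i => by rw [hμ, hT']; simpa using hT i) (fun i => hφ _) (fun i => hdom _)
    (S := {s | 0 ≤ s}) (by simp)
    (fun s hs i => add_nonneg hs (star_mul_self_nonneg _)) (fun s hs => hs)
    (W := {w | ‖w‖ ≤ 1})
    ((CStarAlgebra.norm_le_one_iff_of_nonneg _ zero_le_one).2 le_rfl) (fun w hw => hw)
    (fun w hw s hs => norm_mul_le_one (norm_one_sub_cutoff_le hs) hw)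
    (fun w _ k => by simpa using hlim _ (hφ _) w)
  refine ⟨θ, hθ, fun L => Good (L.map star), h0, fun L hL => ?_, fun L hL E hE => ?_⟩
  · have := h2 _ hL
    simpa [List.map_map, Function.comp_def] using this
  · obtain ⟨i, hi, g, hg, hTg, hgood⟩ := hstep _ hL E hE
    refine ⟨i, hi, star g * y i, norm_mul_le_one (by simpa using hg) (hy i), ?_, ?_⟩
    · rw [hT'] at hTg
      simpa [mul_assoc] using hTg
    · simpa using hgood

end LeftStage

section History

/-- The list of the first `n` values of a sequence, the latest one first. -/
def history {α : Type*} (f : ℕ → α) : ℕ → List α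
  | 0 => []
  | n + 1 => f n :: history f n

variable {α : Type*}

lemma sum_map_history {M : Type*} [AddCommMonoid M] (f : ℕ → α) (h : α → M) (n : ℕ) :
    ((history f n).map h).sum = ∑ i ∈ Finset.range n, h (f i) := by
  induction n with
  | zero => simp [history]
  | succ n ih => rw [history, List.map_cons, List.sum_cons, ih, Finset.sum_range_succ, add_comm]

lemma length_history (f : ℕ → α) (n : ℕ) : (history f n).length = n := by
  induction n with
  | zero => rfl
  | succ n ih => rw [history, List.length_cons, ih]

lemma mem_history_of_lt (f : ℕ → α) {k n : ℕ} (hk : k < n) : f k ∈ history f n := by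
  induction n with
  | zero => omega
  | succ n ih =>
    rcases Nat.lt_succ_iff_lt_or_eq.1 hk with h | rfl
    · exact List.mem_cons_of_mem _ (ih h)
    · exact List.mem_cons_self

lemma history_suffix_of_le (f : ℕ → α) {k n : ℕ} (hk : k ≤ n) : history f k <:+ history f n := by
  induction n, hk using Nat.le_induction with
  | base => exact List.suffix_rfl
  | succ n _ ih => exact ih.trans (List.suffix_cons _ _)

/-- Dependent choice with access to the whole list of previous choices. -/
lemma exists_seq_history {Good : List α → Prop} {R : List α → α → Prop} (h0 : Good [])
    (hstep : ∀ L, Good L → ∃ x, R L x ∧ Good (x :: L)) :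
    ∃ f : ℕ → α, ∀ n, Good (history f n) ∧ R (history f n) (f n) := by
  choose x hR hx using hstep
  let g : ℕ → {L // Good L} := fun n =>
    Nat.rec ⟨[], h0⟩ (fun _ L => ⟨x L.1 L.2 :: L.1, hx L.1 L.2⟩) n
  have hg : ∀ n, history (fun n => x (g n).1 (g n).2) n = (g n).1 := by
    intro n
    induction n with
    | zero => rfl
    | succ n ih => rw [history, ih]
  refine ⟨fun n => x (g n).1 (g n).2, fun n => ?_⟩
  rw [hg]
  exact ⟨(g n).2, hR _ _⟩

end History

section TwoSided

variable {A Y : Type*} [CStarAlgebra A]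

/-- The additive monoid generated by the squares of the elements of a list. -/
def squareMonoid (L : List A) : AddSubmonoid A :=
  AddSubmonoid.closure {s | ∃ v ∈ L, s = star v * v}

/-- The multiplicative monoid generated by the complementary cutoffs of `squareMonoid L`. -/
def cutoffMonoid (L : List A) : Submonoid A :=
  Submonoid.closure {w | ∃ s ∈ squareMonoid L, w = 1 - cutoff s}

lemma squareMonoid_mono {L L' : List A} (h : L ⊆ L') : squareMonoid L ≤ squareMonoid L' :=
  AddSubmonoid.closure_mono fun _ ⟨v, hv, hs⟩ => ⟨v, h hv, hs⟩

lemma cutoffMonoid_mono {L L' : List A} (h : L ⊆ L') : cutoffMonoid L ≤ cutoffMonoid L' :=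
  Submonoid.closure_mono fun _ ⟨s, hs, hw⟩ => ⟨s, squareMonoid_mono h hs, hw⟩

lemma countable_cutoffMonoid (L : List A) : (cutoffMonoid L : Set A).Countable := by
  have h1 : {s | ∃ v ∈ L, s = star v * v}.Countable := by
    refine (L.finite_toSet.image fun v => star v * v).countable.mono ?_
    rintro _ ⟨v, hv, rfl⟩
    exact ⟨v, hv, rfl⟩
  have h2 : (squareMonoid L : Set A).Countable := by
    have := h1.to_subtype
    rw [squareMonoid, AddSubmonoid.closure_eq_mrange]
    exact Set.countable_range _
  have h3 : {w | ∃ s ∈ squareMonoid L, w = 1 - cutoff s}.Countable := by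
    refine (h2.image fun s => 1 - cutoff s).mono ?_
    rintro _ ⟨s, hs, rfl⟩
    exact ⟨s, hs, rfl⟩
  have := h3.to_subtype
  rw [cutoffMonoid, Submonoid.closure_eq_mrange]
  exact Set.countable_range _

lemma exists_enum_cutoffMonoid (L : List A) : ∃ e : ℕ → A, (cutoffMonoid L : Set A) = Set.range e :=
  (countable_cutoffMonoid L).exists_eq_range ⟨1, one_mem _⟩

variable [PartialOrder A] [StarOrderedRing A]

lemma nonneg_of_mem_squareMonoid {L : List A} {s : A} (hs : s ∈ squareMonoid L) : 0 ≤ s := by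
  induction hs using AddSubmonoid.closure_induction with
  | mem s hs => obtain ⟨v, -, rfl⟩ := hs; exact star_mul_self_nonneg v
  | zero => exact le_rfl
  | add _ _ _ _ h1 h2 => exact add_nonneg h1 h2

lemma norm_le_one_of_mem_cutoffMonoid {L : List A} {w : A} (hw : w ∈ cutoffMonoid L) :
    ‖w‖ ≤ 1 := by
  induction hw using Submonoid.closure_induction with
  | mem w hw =>
    obtain ⟨s, hs, rfl⟩ := hw
    exact norm_one_sub_cutoff_le (nonneg_of_mem_squareMonoid hs)
  | one => exact (CStarAlgebra.norm_le_one_iff_of_nonneg _ zero_le_one).2 le_rfl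
  | mul _ _ _ _ h1 h2 => exact norm_mul_le_one h1 h2

lemma norm_le_two_of_le_two_smul_one {a : A} (ha : 0 ≤ a) (h : a ≤ 2 • 1) : ‖a‖ ≤ 2 := by
  have h1 : ‖(1 : A)‖ ≤ 1 := (CStarAlgebra.norm_le_one_iff_of_nonneg _ zero_le_one).2 le_rfl
  refine (CStarAlgebra.norm_le_norm_of_nonneg_of_le ha h).trans ?_
  rw [two_smul]
  linarith [norm_add_le (1 : A) 1]

variable [NormedAddCommGroup Y] [NormedSpace ℂ Y]

/-- A sequence whose left factors have summable squares, and along which the right factors are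
asymptotically small for all the positive functionals that control `T`. -/
lemma exists_seq_left_summable {ι : Type*} {l : Filter ι} [l.NeBot] (T : A →L[ℂ] Y)
    {y z : ι → A} (hy : ∀ i, ‖y i‖ ≤ 1) (hz : ∀ i, ‖z i‖ ≤ 1) {ε : ℝ} (hε : 0 < ε)
    (hT : ∀ i, ε ≤ ‖T (y i * z i)‖)
    (hlim : ∀ φ : A →ₗ[ℝ] ℝ, (∀ a, 0 ≤ a → 0 ≤ φ a) → ∀ w,
      Tendsto (fun i => φ (star w * (y i * star (y i)) * w)) l (𝓝 0))
    (hlim' : ∀ φ : A →ₗ[ℝ] ℝ, (∀ a, 0 ≤ a → 0 ≤ φ a) → ∀ w,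
      Tendsto (fun i => φ (star w * (star (z i) * z i) * w)) l (𝓝 0))
    {φ : A → A →ₗ[ℝ] ℝ} (hφ : ∀ x a, 0 ≤ a → 0 ≤ φ x a) :
    ∃ θ > 0, ∃ u v : ℕ → A, (∀ n, ‖u n‖ ≤ 1) ∧ (∀ n, ‖v n‖ ≤ 1) ∧
      (∀ n, θ < ‖T (u n * v n)‖) ∧
      (∀ n, ∑ i ∈ Finset.range n, u i * star (u i) ≤ 2 • 1) ∧
      ∀ m, ∀ w ∈ cutoffMonoid (history v m), ∀ k,
        Tendsto (fun n => φ (u k * v k) (star w * (star (v n) * v n) * w)) atTop (𝓝 0) := by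
  obtain ⟨θ, hθ, Good, h0, h2, hstep⟩ := exists_left_selection (l := l) T hy hz hε hT hlim
  choose e he using exists_enum_cutoffMonoid (A := A)
  let R : List (A × A) → A × A → Prop := fun L x => ‖x.1‖ ≤ 1 ∧ ‖x.2‖ ≤ 1 ∧ θ < ‖T (x.1 * x.2)‖ ∧
    ∀ L' ∈ L.tails, ∀ j ∈ Finset.range (L.length + 1), ∀ a ∈ L,
      φ (a.1 * a.2) (star (e (L'.map Prod.snd) j) * (star x.2 * x.2) * e (L'.map Prod.snd) j)
        < 1 / ((L.length : ℝ) + 1)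
  obtain ⟨f, hf⟩ := exists_seq_history (Good := fun L : List (A × A) => Good (L.map Prod.fst))
    (R := R) h0 (by
      intro L hL
      have hev : ∀ᶠ i in l, ∀ L' ∈ L.tails, ∀ j ∈ Finset.range (L.length + 1), ∀ a ∈ L,
          φ (a.1 * a.2)
            (star (e (L'.map Prod.snd) j) * (star (z i) * z i) * e (L'.map Prod.snd) j)
            < 1 / ((L.length : ℝ) + 1) := by
        refine (eventually_all_finite L.tails.finite_toSet).2 fun L' _ => ?_
        refine (eventually_all_finset _).2 fun j _ => ?_
        refine (eventually_all_finite L.finite_toSet).2 fun a _ => ?_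
        exact (hlim' _ (hφ _) _).eventually_lt_const (by positivity)
      obtain ⟨i, hi, u, hu, hTu, hgood⟩ := hstep _ hL _ hev
      exact ⟨(u, z i), ⟨hu, hz i, hTu, hi⟩, hgood⟩)
  refine ⟨θ, hθ, fun n => (f n).1, fun n => (f n).2, fun n => (hf n).2.1, fun n => (hf n).2.2.1,
    fun n => (hf n).2.2.2.1, fun n => ?_, fun m w hw k => ?_⟩
  · have := h2 _ (hf n).1
    rwa [List.map_map, sum_map_history] at this
  · have hmap : ∀ n, history (fun n => (f n).2) n = (history f n).map Prod.snd := by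
      intro n
      induction n with
      | zero => rfl
      | succ n ih => rw [history, history, ih, List.map_cons]
    rw [hmap, ← SetLike.mem_coe, he] at hw
    obtain ⟨j, rfl⟩ := hw
    refine squeeze_zero' (.of_forall fun n =>
      hφ _ _ (star_left_conjugate_nonneg (star_mul_self_nonneg _) _)) ?_
      tendsto_one_div_add_atTop_nhds_zero_nat
    filter_upwards [eventually_gt_atTop m, eventually_gt_atTop k, eventually_gt_atTop j]
      with n hm hk hj
    have := (hf n).2.2.2.2 (history f m) ((List.mem_tails _ _).2 (history_suffix_of_le f hm.le)) j
      (by rw [length_history]; simp; omega) (f k) (mem_history_of_lt f hk)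
    rw [length_history] at this
    exact this.le

theorem exists_two_sided_summable [CompleteSpace Y] {T : A →L[ℂ] Y}
    (hT : ¬ IsWeaklyCompactOperator T) :
    ∃ θ > 0, ∃ u v : ℕ → A, (∀ n, θ < ‖T (u n * v n)‖) ∧
      (∀ n, ‖∑ i ∈ Finset.range n, u i * star (u i)‖ ≤ 2) ∧
      ∀ n, ‖∑ i ∈ Finset.range n, star (v i) * v i‖ ≤ 2 := by
  obtain ⟨ε, hε, hex⟩ := exists_factor_norm_lt_of_not_isWeaklyCompactOperator hT
  let ι := {p : A × A // ‖p.1‖ ≤ 1 ∧ ‖p.2‖ ≤ 1 ∧ ε < ‖T (p.1 * p.2)‖}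
  have hnonneg : ∀ i : ι, 0 ≤ i.1.1 * star i.1.1 + star i.1.2 * i.1.2 := fun i =>
    add_nonneg (mul_star_self_nonneg _) (star_mul_self_nonneg _)
  obtain ⟨l, hl, hlim⟩ := exists_filter_tendsto_zero
    (a := fun i : ι => i.1.1 * star i.1.1 + star i.1.2 * i.1.2) hnonneg
    fun φ hφ δ hδ => by
      obtain ⟨y, z, hy, hz, hφ, hT⟩ := hex φ hφ δ hδ
      exact ⟨⟨(y, z), hy, hz, hT⟩, hφ⟩
  choose μ φ hμT hμ hφ hdom using exists_norming_and_positive_dominating (T.restrictScalars ℝ)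
  obtain ⟨θ, hθ, u, v, hu, hv, hTuv, hsum, htend⟩ := exists_seq_left_summable (l := l) T
    (y := fun i : ι => i.1.1) (z := fun i : ι => i.1.2) (fun i => i.2.1) (fun i => i.2.2.1) hε
    (fun i => i.2.2.2.le)
    (fun ψ hψ w => tendsto_conj_zero (fun i => mul_star_self_nonneg _)
      (fun i => le_add_of_nonneg_right (star_mul_self_nonneg _)) hlim hψ w)
    (fun ψ hψ w => tendsto_conj_zero (fun i => star_mul_self_nonneg _)
      (fun i => le_add_of_nonneg_left (mul_star_self_nonneg _)) hlim hψ w)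
    hφ
  have hsub : ∀ {m n : ℕ}, m ≤ n → history v m ⊆ history v n := fun h =>
    (history_suffix_of_le v h).subset
  obtain ⟨θ', hθ', Good, h0, h2, hstep⟩ := exists_selection (l := atTop)
    (T := T.restrictScalars ℝ) hu hv hθ
    (μ := fun n => μ (u n * v n)) (φ := fun n => φ (u n * v n)) (fun n => hμT _)
    (fun n => by rw [hμ]; exact (hTuv n).le) (fun n => hφ _) (fun n => hdom _)
    (S := ⋃ m, (squareMonoid (history v m) : Set A)) (W := ⋃ m, (cutoffMonoid (history v m) : Set A))
    (Set.mem_iUnion.2 ⟨0, zero_mem _⟩)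
    (by
      intro s hs i
      obtain ⟨m, hm⟩ := Set.mem_iUnion.1 hs
      refine Set.mem_iUnion.2 ⟨max m (i + 1), add_mem ?_ (AddSubmonoid.subset_closure ?_)⟩
      · exact squareMonoid_mono (hsub (le_max_left _ _)) hm
      · exact ⟨v i, mem_history_of_lt v (le_max_right m (i + 1)), rfl⟩)
    (by
      intro s hs
      obtain ⟨m, hm⟩ := Set.mem_iUnion.1 hs
      exact nonneg_of_mem_squareMonoid hm)
    (Set.mem_iUnion.2 ⟨0, one_mem _⟩)
    (by
      intro w hw
      obtain ⟨m, hm⟩ := Set.mem_iUnion.1 hw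
      exact norm_le_one_of_mem_cutoffMonoid hm)
    (by
      intro w hw s hs
      obtain ⟨m, hm⟩ := Set.mem_iUnion.1 hw
      obtain ⟨m', hm'⟩ := Set.mem_iUnion.1 hs
      refine Set.mem_iUnion.2 ⟨max m m', mul_mem (Submonoid.subset_closure ⟨s, ?_, rfl⟩) ?_⟩
      · exact squareMonoid_mono (hsub (le_max_right _ _)) hm'
      · exact cutoffMonoid_mono (hsub (le_max_left _ _)) hm)
    (by
      intro w hw k
      obtain ⟨m, hm⟩ := Set.mem_iUnion.1 hw
      exact htend m w hm k)
  obtain ⟨f, hf⟩ := exists_seq_history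
    (Good := fun L : List (ℕ × A) => Good (L.map fun x => v x.1 * x.2))
    (R := fun L x => (∀ x' ∈ L, x'.1 < x.1) ∧ θ' < ‖T (u x.1 * (v x.1 * x.2))‖) h0 (by
      intro L hL
      have hev : ∀ᶠ n in atTop, ∀ x' ∈ L, x'.1 < n :=
        (eventually_all_finite L.finite_toSet).2 fun x' _ => eventually_gt_atTop _
      obtain ⟨n, hn, g, -, hTg, hgood⟩ := hstep _ hL _ hev
      exact ⟨(n, g), ⟨hn, hTg⟩, hgood⟩)
  have hmono : StrictMono fun j => (f j).1 :=
    strictMono_nat_of_lt_succ fun j => (hf (j + 1)).2.1 _ (mem_history_of_lt f j.lt_succ_self)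
  refine ⟨θ', hθ', fun j => u (f j).1, fun j => v (f j).1 * (f j).2, fun j => (hf j).2.2,
    fun n => ?_, fun n => ?_⟩
  · refine norm_le_two_of_le_two_smul_one
      (Finset.sum_nonneg fun i _ => mul_star_self_nonneg _) (le_trans ?_ (hsum (f n).1))
    rw [← Finset.sum_image (f := fun i => u i * star (u i)) hmono.injective.injOn]
    refine Finset.sum_le_sum_of_subset_of_nonneg ?_ fun _ _ _ => mul_star_self_nonneg _
    intro i hi
    obtain ⟨j, hj, rfl⟩ := Finset.mem_image.1 hi
    exact Finset.mem_range.2 (hmono (Finset.mem_range.1 hj))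
  · have := h2 _ (hf n).1
    rw [List.map_map, sum_map_history] at this
    exact norm_le_two_of_le_two_smul_one (Finset.sum_nonneg fun i _ => star_mul_self_nonneg _) this

end TwoSided

section Rosenthal

/-- The elements of `ℓ∞` that vanish off `N`. -/
def SupportedOn (t : lp (fun _ : ℕ => ℂ) ⊤) (N : Set ℕ) : Prop := ∀ i ∉ N, t i = 0

/-- The variation of `ν` on `N` is at most `c`. -/
def VariationLE (ν : lp (fun _ : ℕ => ℂ) ⊤ →L[ℂ] ℂ) (N : Set ℕ) (c : ℝ) : Prop :=
  ∀ t, SupportedOn t N → ‖t‖ ≤ 1 → ‖ν t‖ ≤ c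

lemma exists_norm_one_mul_eq_norm (z : ℂ) : ∃ α : ℂ, ‖α‖ = 1 ∧ α * z = ‖z‖ := by
  by_cases hz : z = 0
  · exact ⟨1, by simp, by simp [hz]⟩
  · refine ⟨‖z‖ / z, ?_, by field_simp⟩
    have : ‖z‖ ≠ 0 := norm_ne_zero_iff.2 hz
    rw [norm_div, Complex.norm_real, norm_norm, div_self this]

lemma VariationLE.norm_apply_le {ν : lp (fun _ : ℕ => ℂ) ⊤ →L[ℂ] ℂ} {N : Set ℕ} {c C : ℝ}
    (hν : VariationLE ν N c) {t : lp (fun _ : ℕ => ℂ) ⊤} (ht : SupportedOn t N) (htC : ‖t‖ ≤ C) :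
    ‖ν t‖ ≤ c * C := by
  have h0 := (norm_nonneg t).trans htC
  rcases h0.eq_or_lt with rfl | hC
  · simp [norm_le_zero_iff.1 htC]
  · have h := hν ((C⁻¹ : ℂ) • t) (fun i hi => by
      change (C⁻¹ : ℂ) * t i = 0
      rw [ht i hi, mul_zero]) (by
      rw [norm_smul, norm_inv, Complex.norm_real, Real.norm_of_nonneg h0]
      exact inv_mul_le_one_of_le₀ htC h0)
    rw [map_smul, norm_smul, norm_inv, Complex.norm_real, Real.norm_of_nonneg h0] at h
    rw [mul_comm]
    exact (inv_mul_le_iff₀ hC).1 h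

lemma norm_add_norm_le_of_variationLE {ν : lp (fun _ : ℕ => ℂ) ⊤ →L[ℂ] ℂ} {N N₁ N₂ : Set ℕ} {c : ℝ}
    (hν : VariationLE ν N c) (h₁ : N₁ ⊆ N) (h₂ : N₂ ⊆ N) (hd : Disjoint N₁ N₂)
    {t₁ t₂ : lp (fun _ : ℕ => ℂ) ⊤} (ht₁ : SupportedOn t₁ N₁) (ht₂ : SupportedOn t₂ N₂)
    (hn₁ : ‖t₁‖ ≤ 1) (hn₂ : ‖t₂‖ ≤ 1) : ‖ν t₁‖ + ‖ν t₂‖ ≤ c := by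
  obtain ⟨α, hα, hα'⟩ := exists_norm_one_mul_eq_norm (ν t₁)
  obtain ⟨β, hβ, hβ'⟩ := exists_norm_one_mul_eq_norm (ν t₂)
  have hsum : ν (α • t₁ + β • t₂) = ((‖ν t₁‖ + ‖ν t₂‖ : ℝ) : ℂ) := by
    simp [hα', hβ']
  have h := hν (α • t₁ + β • t₂) (fun i hi => ?_) (lp.norm_le_of_forall_le zero_le_one fun i => ?_)
  · rw [hsum, Complex.norm_real] at h
    exact (le_abs_self _).trans h
  · change α * t₁ i + β * t₂ i = 0
    simp [ht₁ i fun h => hi (h₁ h), ht₂ i fun h => hi (h₂ h)]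
  · change ‖α * t₁ i + β * t₂ i‖ ≤ 1
    by_cases hi : i ∈ N₁
    · have h2 := ht₂ i (hd.notMem_of_mem_left hi)
      have := (lp.norm_apply_le_norm ENNReal.top_ne_zero t₁ i).trans hn₁
      simpa [h2, hα] using this
    · have h1 := ht₁ i hi
      have := (lp.norm_apply_le_norm ENNReal.top_ne_zero t₂ i).trans hn₂
      simpa [h1, hβ] using this

lemma exists_disjoint_infinite_subsets {N : Set ℕ} (hN : N.Infinite) :
    ∃ M : ℕ → Set ℕ, (∀ k, (M k).Infinite) ∧ (∀ k, M k ⊆ N) ∧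
      ∀ k k', k ≠ k' → Disjoint (M k) (M k') := by
  classical
  have := hN.to_subtype
  let g : ℕ × ℕ → ℕ := fun p => (Nat.orderEmbeddingOfSet N) (Nat.pairEquiv p)
  have hg : g.Injective := (Nat.orderEmbeddingOfSet N).injective.comp Nat.pairEquiv.injective
  refine ⟨fun k => Set.range fun i => g (k, i), fun k => ?_, fun k => ?_, fun k k' hk => ?_⟩
  · exact Set.infinite_range_of_injective (hg.comp (Prod.mk_right_injective k))
  · rintro _ ⟨i, rfl⟩
    have := Set.mem_range_self (f := Nat.orderEmbeddingOfSet N) (Nat.pairEquiv (k, i))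
    rwa [Nat.orderEmbeddingOfSet_range] at this
  · refine Set.disjoint_left.2 ?_
    rintro _ ⟨i, rfl⟩ ⟨i', h⟩
    exact hk (congrArg Prod.fst (hg h.symm))

/-- Rosenthal's lemma. -/
lemma exists_infinite_variationLE {ν : ℕ → lp (fun _ : ℕ => ℂ) ⊤ →L[ℂ] ℂ} {c : ℝ} (hc : 0 ≤ c)
    (n : ℕ) : ∀ N : Set ℕ, N.Infinite → (∀ j ∈ N, VariationLE (ν j) N (n * c)) →
      ∃ M ⊆ N, M.Infinite ∧ ∀ j ∈ M, VariationLE (ν j) (M \ {j}) c := by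
  induction n with
  | zero =>
    refine fun N hN h => ⟨N, subset_rfl, hN, fun j hj t ht ht1 => ?_⟩
    refine (h j hj t (fun i hi => ht i fun h' => hi h'.1) ht1).trans ?_
    simpa using hc
  | succ n ih =>
    intro N hN h
    obtain ⟨M, hM, hMN, hMd⟩ := exists_disjoint_infinite_subsets hN
    by_cases hex : ∃ k, ∀ j ∈ M k, VariationLE (ν j) (M k \ {j}) c
    · obtain ⟨k, hk⟩ := hex
      exact ⟨M k, hMN k, hM k, hk⟩
    · simp only [VariationLE] at hex
      push Not at hex
      choose j hj t ht ht1 htc using hex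
      have hjinj : j.Injective := by
        intro k k' hkk
        by_contra hne
        exact Set.disjoint_left.1 (hMd k k' hne) (hj k) (hkk ▸ hj k')
      have hjN : Set.range j ⊆ N := Set.range_subset_iff.2 fun k => hMN k (hj k)
      obtain ⟨M', hM', hM'inf, hM'v⟩ := ih (Set.range j) (Set.infinite_range_of_injective hjinj) (by
        rintro _ ⟨k, rfl⟩ s hs hs1
        have hd : Disjoint (Set.range j) (M k \ {j k}) := by
          refine Set.disjoint_left.2 ?_
          rintro _ ⟨k', rfl⟩ ⟨h1, h2⟩
          by_cases hkk : k' = k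
          · exact h2 (by rw [hkk]; rfl)
          · exact Set.disjoint_left.1 (hMd k' k hkk) (hj k') h1
        have := norm_add_norm_le_of_variationLE (h (j k) (hMN k (hj k))) hjN
          (Set.sdiff_subset.trans (hMN k)) hd hs (ht k) hs1 (ht1 k)
        have h1 := htc k
        push_cast at this
        linarith)
      exact ⟨M', hM'.trans hjN, hM'inf, hM'v⟩

lemma lp_norm_extend_apply_le {σ : ℕ → ℕ} (hσ : σ.Injective) (t : lp (fun _ : ℕ => ℂ) ⊤) (i : ℕ) :
    ‖Function.extend σ t 0 i‖ ≤ ‖t‖ := by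
  by_cases hi : ∃ k, σ k = i
  · obtain ⟨k, rfl⟩ := hi
    rw [hσ.extend_apply]
    exact lp.norm_apply_le_norm ENNReal.top_ne_zero t k
  · rw [Function.extend_apply' _ _ _ hi]
    simp

/-- The isometric embedding of `ℓ∞` into itself given by an injection of the index set. -/
noncomputable def lpExtend {σ : ℕ → ℕ} (hσ : σ.Injective) :
    lp (fun _ : ℕ => ℂ) ⊤ →ₗᵢ[ℂ] lp (fun _ : ℕ => ℂ) ⊤ where
  toFun t := ⟨Function.extend σ t 0, memℓp_infty ⟨‖t‖, by
    rintro _ ⟨i, rfl⟩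
    exact lp_norm_extend_apply_le hσ t i⟩⟩
  map_add' s t := by
    ext i
    change Function.extend σ (⇑s + ⇑t) 0 i = Function.extend σ s 0 i + Function.extend σ t 0 i
    by_cases hi : ∃ k, σ k = i
    · obtain ⟨k, rfl⟩ := hi
      simp [hσ.extend_apply]
    · simp [Function.extend_apply' _ _ _ hi]
  map_smul' c t := by
    ext i
    change Function.extend σ (c • ⇑t) 0 i = c * Function.extend σ t 0 i
    by_cases hi : ∃ k, σ k = i
    · obtain ⟨k, rfl⟩ := hi
      simp [hσ.extend_apply]
    · simp [Function.extend_apply' _ _ _ hi]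
  norm_map' t := by
    refine le_antisymm (lp.norm_le_of_forall_le (norm_nonneg t) (lp_norm_extend_apply_le hσ t))
      (lp.norm_le_of_forall_le (norm_nonneg _) fun k => ?_)
    refine le_of_eq_of_le ?_ (lp.norm_apply_le_norm ENNReal.top_ne_zero _ (σ k))
    exact congrArg norm (hσ.extend_apply (t : ℕ → ℂ) 0 k).symm

lemma supportedOn_lpExtend {σ : ℕ → ℕ} (hσ : σ.Injective) (t : lp (fun _ : ℕ => ℂ) ⊤) :
    SupportedOn (lpExtend hσ t) (Set.range σ) := fun _ hi =>
  Function.extend_apply' _ _ _ hi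

theorem exists_isometry_bounded_below {Y : Type*} [NormedAddCommGroup Y] [NormedSpace ℂ Y]
    {R : lp (fun _ : ℕ => ℂ) ⊤ →L[ℂ] Y} {θ : ℝ} (hθ : 0 < θ)
    (hR : ∀ j, θ < ‖R (lp.single ⊤ j 1)‖) :
    ∃ J : lp (fun _ : ℕ => ℂ) ⊤ →ₗᵢ[ℂ] lp (fun _ : ℕ => ℂ) ⊤, ∀ t, θ / 2 * ‖t‖ ≤ ‖R (J t)‖ := by
  choose f hf hfR using fun j => exists_dual_vector'' ℂ (R (lp.single ⊤ j 1))
  obtain ⟨n, hn⟩ := exists_nat_ge (‖R‖ / (θ / 2))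
  have hfle : ∀ j t, ‖f j (R t)‖ ≤ ‖R t‖ := fun j t =>
    ((f j).le_opNorm _).trans (mul_le_of_le_one_left (norm_nonneg _) (hf j))
  obtain ⟨M, -, hM, hν⟩ := exists_infinite_variationLE (ν := fun j => f j ∘L R) (c := θ / 2)
    (by positivity) n Set.univ Set.infinite_univ (by
      intro j _ t _ ht
      calc ‖f j (R t)‖ ≤ ‖R‖ * ‖t‖ := (hfle j t).trans (R.le_opNorm t)
        _ ≤ ‖R‖ := mul_le_of_le_one_right (norm_nonneg _) ht
        _ ≤ n * (θ / 2) := (div_le_iff₀ (by positivity)).1 hn)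
  classical
  have := hM.to_subtype
  let σ := Nat.orderEmbeddingOfSet M
  refine ⟨lpExtend σ.injective, fun t => ?_⟩
  have hs : SupportedOn (lpExtend σ.injective t) M := by
    have := supportedOn_lpExtend σ.injective t
    rwa [Nat.orderEmbeddingOfSet_range] at this
  rw [← (lpExtend σ.injective).norm_map t]
  generalize lpExtend σ.injective t = s at hs
  have key : ∀ j, ‖s j‖ ≤ (‖R s‖ + θ / 2 * ‖s‖) / θ := by
    intro j
    by_cases hj : j ∈ M
    · rw [le_div_iff₀ hθ]
      have hself : (lp.single ⊤ j (1 : ℂ) : lp (fun _ : ℕ => ℂ) ⊤) j = 1 := lp.single_apply_self ..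
      set r := s - s j • (lp.single ⊤ j 1 : lp (fun _ : ℕ => ℂ) ⊤) with hr
      have hrj : r j = 0 := by
        change s j - s j * (lp.single ⊤ j (1 : ℂ) : lp (fun _ : ℕ => ℂ) ⊤) j = 0
        rw [hself]; simp
      have hri : ∀ i, i ≠ j → r i = s i := by
        intro i hi
        change s i - s j * (lp.single ⊤ j (1 : ℂ) : lp (fun _ : ℕ => ℂ) ⊤) i = s i
        rw [lp.single_apply_ne _ _ _ hi]; simp
      have hrs : SupportedOn r (M \ {j}) := by
        intro i hi
        by_cases hij : i = j
        · rw [hij, hrj]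
        · rw [hri i hij]
          exact hs i fun h => hi ⟨h, hij⟩
      have hrn : ‖r‖ ≤ ‖s‖ := by
        refine lp.norm_le_of_forall_le (norm_nonneg s) fun i => ?_
        by_cases hij : i = j
        · rw [hij, hrj]; simp
        · rw [hri i hij]
          exact lp.norm_apply_le_norm ENNReal.top_ne_zero s i
      have h1 : ‖f j (R r)‖ ≤ θ / 2 * ‖s‖ := (hν j hj).norm_apply_le hrs hrn
      have h2 : f j (R s) = f j (R r) + s j * ‖R (lp.single ⊤ j 1)‖ := by
        have : s = r + s j • (lp.single ⊤ j 1 : lp (fun _ : ℕ => ℂ) ⊤) := by rw [hr]; abel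
        conv_lhs => rw [this]
        rw [map_add, map_add, map_smul, map_smul, hfR]
        rfl
      have h3 : ‖s j * (‖R (lp.single ⊤ j 1)‖ : ℂ)‖ ≤ ‖f j (R s)‖ + ‖f j (R r)‖ := by
        rw [eq_sub_of_add_eq' h2.symm]
        exact norm_sub_le _ _
      rw [norm_mul, Complex.norm_real, norm_norm] at h3
      have h4 := mul_le_mul_of_nonneg_left (hR j).le (norm_nonneg (s j))
      linarith [hfle j s]
    · rw [hs j hj, norm_zero]
      positivity
  have h := lp.norm_le_of_forall_le (by positivity) key
  rw [le_div_iff₀ hθ] at h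
  linarith

end Rosenthal

section StrongSums

variable {H : Type*} [NormedAddCommGroup H] [InnerProductSpace ℂ H] [CompleteSpace H]
  {u v : ℕ → H →L[ℂ] H} {C : ℝ}

lemma sum_norm_apply_sq_le (hv : ∀ n, ‖∑ i ∈ Finset.range n, star (v i) * v i‖ ≤ C)
    (F : Finset ℕ) (ξ : H) : ∑ i ∈ F, ‖v i ξ‖ ^ 2 ≤ C * ‖ξ‖ ^ 2 := by
  obtain ⟨n, hn⟩ := F.exists_nat_subset_range
  calc ∑ i ∈ F, ‖v i ξ‖ ^ 2 ≤ ∑ i ∈ Finset.range n, ‖v i ξ‖ ^ 2 :=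
        Finset.sum_le_sum_of_subset_of_nonneg hn fun _ _ _ => sq_nonneg _
    _ = RCLike.re (inner ℂ ((∑ i ∈ Finset.range n, star (v i) * v i) ξ) ξ) := by
        rw [sum_apply, sum_inner, map_sum]
        refine Finset.sum_congr rfl fun i _ => ?_
        exact (v i).apply_norm_sq_eq_inner_adjoint_left ξ
    _ ≤ ‖(∑ i ∈ Finset.range n, star (v i) * v i) ξ‖ * ‖ξ‖ := re_inner_le_norm _ _
    _ ≤ C * ‖ξ‖ * ‖ξ‖ := by
        gcongr
        exact ContinuousLinearMap.le_of_opNorm_le _ (hv n) ξ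
    _ = C * ‖ξ‖ ^ 2 := by ring

lemma norm_sum_smul_apply_sq_le (hu : ∀ n, ‖∑ i ∈ Finset.range n, u i * star (u i)‖ ≤ C)
    {t : ℕ → ℂ} {K : ℝ} (ht : ∀ i, ‖t i‖ ≤ K) (F : Finset ℕ) (ξ : H) :
    ‖∑ i ∈ F, t i • (u i * v i) ξ‖ ^ 2 ≤ C * K ^ 2 * ∑ i ∈ F, ‖v i ξ‖ ^ 2 := by
  set x := ∑ i ∈ F, t i • (u i * v i) ξ with hx
  have hK : 0 ≤ K := (norm_nonneg _).trans (ht 0)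
  have hC : 0 ≤ C := (norm_nonneg _).trans (hu 0)
  have h1 : ‖x‖ ^ 2 ≤ K * ∑ i ∈ F, ‖v i ξ‖ * ‖star (u i) x‖ := by
    calc ‖x‖ ^ 2 = RCLike.re (inner ℂ x x) := (inner_self_eq_norm_sq x).symm
      _ = ∑ i ∈ F, RCLike.re (inner ℂ (t i • (u i * v i) ξ) x) := by
        rw [← map_sum, ← sum_inner]
      _ ≤ ∑ i ∈ F, K * (‖v i ξ‖ * ‖star (u i) x‖) := by
        refine Finset.sum_le_sum fun i _ => ?_
        have : inner ℂ (t i • (u i * v i) ξ) x = inner ℂ (t i • v i ξ) (star (u i) x) := by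
          rw [ContinuousLinearMap.star_eq_adjoint, ContinuousLinearMap.adjoint_inner_right,
            map_smul]
          rfl
        rw [this]
        refine (re_inner_le_norm _ _).trans ?_
        rw [norm_smul, mul_assoc]
        exact mul_le_mul_of_nonneg_right (ht i) (by positivity)
      _ = _ := by rw [Finset.mul_sum]
  have h2 := Finset.sum_mul_sq_le_sq_mul_sq F (fun i => ‖v i ξ‖) (fun i => ‖star (u i) x‖)
  have h3 := sum_norm_apply_sq_le (v := fun i => star (u i)) (by simpa using hu) F x
  set P := ∑ i ∈ F, ‖v i ξ‖ ^ 2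
  have hP : 0 ≤ P := Finset.sum_nonneg fun _ _ => sq_nonneg _
  rcases (norm_nonneg x).eq_or_lt with h0 | h0
  · rw [← h0, zero_pow two_ne_zero]
    exact mul_nonneg (by positivity) hP
  · have h4 : ‖x‖ ^ 2 * ‖x‖ ^ 2 ≤ C * K ^ 2 * P * ‖x‖ ^ 2 := by
      calc ‖x‖ ^ 2 * ‖x‖ ^ 2 ≤ (K * ∑ i ∈ F, ‖v i ξ‖ * ‖star (u i) x‖) ^ 2 := by
            rw [sq (K * _)]
            exact mul_self_le_mul_self (by positivity) h1
        _ ≤ K ^ 2 * (P * (C * ‖x‖ ^ 2)) := by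
            rw [mul_pow]
            gcongr
            exact h2.trans (by gcongr)
        _ = _ := by ring
    exact le_of_mul_le_mul_right h4 (by positivity)

lemma summable_smul_apply (hu : ∀ n, ‖∑ i ∈ Finset.range n, u i * star (u i)‖ ≤ C)
    (hv : ∀ n, ‖∑ i ∈ Finset.range n, star (v i) * v i‖ ≤ C)
    {t : ℕ → ℂ} {K : ℝ} (ht : ∀ i, ‖t i‖ ≤ K) (ξ : H) :
    Summable fun i => t i • (u i * v i) ξ := by
  have hC : 0 ≤ C := (norm_nonneg _).trans (hu 0)
  have hs : Summable fun i => ‖v i ξ‖ ^ 2 :=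
    summable_of_sum_le (fun _ => sq_nonneg _) fun F => sum_norm_apply_sq_le hv F ξ
  rw [summable_iff_vanishing_norm] at hs ⊢
  intro ε hε
  obtain ⟨s, hs⟩ := hs (ε ^ 2 / (C * K ^ 2 + 1)) (by positivity)
  refine ⟨s, fun F hF => ?_⟩
  have h1 := (le_abs_self _).trans_lt (hs F hF)
  have h2 := norm_sum_smul_apply_sq_le (v := v) hu ht F ξ
  refine lt_of_pow_lt_pow_left₀ 2 hε.le ?_
  rw [lt_div_iff₀ (by positivity)] at h1
  have hP : 0 ≤ ∑ i ∈ F, ‖v i ξ‖ ^ 2 := Finset.sum_nonneg fun _ _ => sq_nonneg _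
  linarith

lemma norm_tsum_smul_apply_le (hu : ∀ n, ‖∑ i ∈ Finset.range n, u i * star (u i)‖ ≤ C)
    (hv : ∀ n, ‖∑ i ∈ Finset.range n, star (v i) * v i‖ ≤ C)
    {t : ℕ → ℂ} {K : ℝ} (ht : ∀ i, ‖t i‖ ≤ K) (ξ : H) :
    ‖∑' i, t i • (u i * v i) ξ‖ ≤ C * K * ‖ξ‖ := by
  have hC : 0 ≤ C := (norm_nonneg _).trans (hu 0)
  have hK : 0 ≤ K := (norm_nonneg _).trans (ht 0)
  refine le_of_tendsto (summable_smul_apply hu hv ht ξ).hasSum.norm (Eventually.of_forall fun F => ?_)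
  refine le_of_sq_le_sq ?_ (by positivity)
  calc ‖∑ i ∈ F, t i • (u i * v i) ξ‖ ^ 2 ≤ C * K ^ 2 * ∑ i ∈ F, ‖v i ξ‖ ^ 2 :=
        norm_sum_smul_apply_sq_le hu ht F ξ
    _ ≤ C * K ^ 2 * (C * ‖ξ‖ ^ 2) := by
        gcongr
        exact sum_norm_apply_sq_le hv F ξ
    _ = (C * K * ‖ξ‖) ^ 2 := by ring

theorem exists_clm_single_eq_mul (hu : ∀ n, ‖∑ i ∈ Finset.range n, u i * star (u i)‖ ≤ C)
    (hv : ∀ n, ‖∑ i ∈ Finset.range n, star (v i) * v i‖ ≤ C) :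
    ∃ S : lp (fun _ : ℕ => ℂ) ⊤ →L[ℂ] H →L[ℂ] H, (∀ j, S (lp.single ⊤ j 1) = u j * v j) ∧
      ∀ t b, (∀ j, Commute b (u j * v j)) → Commute b (S t) := by
  have hle := fun t : lp (fun _ : ℕ => ℂ) ⊤ => lp.norm_apply_le_norm ENNReal.top_ne_zero t
  have hsum := fun t : lp (fun _ : ℕ => ℂ) ⊤ => summable_smul_apply hu hv (hle t)
  let S₀ : lp (fun _ : ℕ => ℂ) ⊤ →ₗ[ℂ] H →ₗ[ℂ] H :=
    LinearMap.mk₂ ℂ (fun t ξ => ∑' i, t i • (u i * v i) ξ)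
      (fun s t ξ => by
        rw [← (hsum s ξ).tsum_add (hsum t ξ)]
        exact tsum_congr fun i => add_smul (s i) (t i) _)
      (fun c t ξ => by
        rw [← (hsum t ξ).tsum_const_smul c]
        exact tsum_congr fun i => mul_smul c (t i) _)
      (fun t ξ η => by
        rw [← (hsum t ξ).tsum_add (hsum t η)]
        exact tsum_congr fun i => by rw [map_add, smul_add])
      (fun c t ξ => by
        rw [← (hsum t ξ).tsum_const_smul c]
        exact tsum_congr fun i => by rw [map_smul, smul_comm])
  refine ⟨S₀.mkContinuous₂ C fun t ξ => norm_tsum_smul_apply_le hu hv (hle t) ξ, fun j => ?_,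
    fun t b hb => ?_⟩
  · ext ξ
    change ∑' i, (lp.single ⊤ j (1 : ℂ) : lp (fun _ : ℕ => ℂ) ⊤) i • (u i * v i) ξ = _
    rw [tsum_eq_single j fun i hi => by rw [lp.single_apply_ne _ _ _ hi, zero_smul],
      lp.single_apply_self, one_smul]
  · ext ξ
    change b (∑' i, t i • (u i * v i) ξ) = ∑' i, t i • (u i * v i) (b ξ)
    rw [b.map_tsum (hsum t ξ)]
    refine tsum_congr fun i => ?_
    rw [map_smul]
    exact congrArg (t i • ·) (DFunLike.congr_fun (hb i).eq ξ)

end StrongSums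

section Conclusion

lemma exists_closed_subspace_of_bounded_below {X E Y : Type*} [NormedAddCommGroup X]
    [NormedSpace ℂ X] [CompleteSpace X] [NormedAddCommGroup E] [NormedSpace ℂ E]
    [NormedAddCommGroup Y] [NormedSpace ℂ Y] {T : E →L[ℂ] Y} {U : X →L[ℂ] E} {c : ℝ} (hc : 0 < c)
    (hU : ∀ t, c * ‖t‖ ≤ ‖T (U t)‖) :
    ∃ F : Submodule ℂ E, IsClosed (F : Set E) ∧ Nonempty (F ≃L[ℂ] X) ∧
      ∃ c : ℝ, 0 < c ∧ ∀ x ∈ F, c * ‖x‖ ≤ ‖T x‖ := by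
  have hb : ∀ t, ‖t‖ ≤ ‖T‖ / c * ‖U t‖ := fun t => by
    rw [div_mul_eq_mul_div, le_div_iff₀ hc, mul_comm]
    exact (hU t).trans (T.le_opNorm _)
  have hanti : AntilipschitzWith (‖T‖ / c).toNNReal U :=
    AddMonoidHomClass.antilipschitz_of_bound U fun t => by
      rw [Real.coe_toNNReal _ (by positivity)]
      exact hb t
  refine ⟨LinearMap.range (U : X →ₗ[ℂ] E), ?_, ?_, c / (‖U‖ + 1), by positivity, ?_⟩
  · exact hanti.isClosed_range U.uniformContinuous
  · exact ⟨((LinearEquiv.ofInjective (U : X →ₗ[ℂ] E) hanti.injective).toContinuousLinearEquivOfBounds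
      ‖U‖ (‖T‖ / c) U.le_opNorm fun x => by
        obtain ⟨t, rfl⟩ := (LinearEquiv.ofInjective (U : X →ₗ[ℂ] E) hanti.injective).surjective x
        rw [LinearEquiv.symm_apply_apply]
        exact hb t).symm⟩
  · rintro _ ⟨t, rfl⟩
    refine le_trans ?_ (hU t)
    rw [div_mul_eq_mul_div]
    refine div_le_of_le_mul₀ (by positivity) (by positivity) ?_
    rw [mul_assoc]
    refine mul_le_mul_of_nonneg_left ((U.le_opNorm t).trans ?_) hc.le
    rw [mul_comm]
    gcongr
    linarith

/-- The order-free form of `exists_two_sided_summable`. -/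
lemma exists_two_sided_summable_of_cstarAlgebra {B Y : Type*} [CStarAlgebra B]
    [NormedAddCommGroup Y] [NormedSpace ℂ Y] [CompleteSpace Y] {T : B →L[ℂ] Y}
    (hT : ¬ IsWeaklyCompactOperator T) :
    ∃ θ > 0, ∃ u v : ℕ → B, (∀ n, θ < ‖T (u n * v n)‖) ∧
      (∀ n, ‖∑ i ∈ Finset.range n, u i * star (u i)‖ ≤ 2) ∧
      ∀ n, ‖∑ i ∈ Finset.range n, star (v i) * v i‖ ≤ 2 :=
  letI := CStarAlgebra.spectralOrder B
  haveI := CStarAlgebra.spectralOrderedRing B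
  exists_two_sided_summable hT

variable {H : Type*} [NormedAddCommGroup H] [InnerProductSpace ℂ H] [CompleteSpace H]

lemma VonNeumannAlgebra.mem_of_forall_commute {A : VonNeumannAlgebra H} {x : H →L[ℂ] H}
    (hx : ∀ b, (∀ a ∈ A, Commute b a) → Commute b x) : x ∈ A := by
  rw [← SetLike.mem_coe, ← A.centralizer_centralizer]
  exact fun b hb => hx b fun a ha => (hb a ha).symm

lemma VonNeumannAlgebra.isClosed_toStarSubalgebra (A : VonNeumannAlgebra H) :
    IsClosed (A.toStarSubalgebra : Set (H →L[ℂ] H)) := by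
  rw [A.coe_toStarSubalgebra, ← A.centralizer_centralizer]
  exact Set.isClosed_centralizer _

end Conclusion

/-- If `A` is a von Neumann algebra (regarded as a complex Banach space) and `T : A → Y` is a
bounded operator which is not weakly compact, then there is a closed subspace `E` of `A`
isomorphic to `ℓ∞` on which `T` is an isomorphism onto its image (i.e. bounded below). -/
theorem exists_ell_infty_subspace_of_not_weaklyCompact
    (H : Type*) [NormedAddCommGroup H] [InnerProductSpace ℂ H] [CompleteSpace H]
    (A : VonNeumannAlgebra H)
    (Y : Type*) [NormedAddCommGroup Y] [NormedSpace ℂ Y] [CompleteSpace Y]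
    (T : A.toStarSubalgebra.toSubalgebra →L[ℂ] Y)
    (hT : ¬ IsWeaklyCompactOperator T) :
    ∃ E : Submodule ℂ A.toStarSubalgebra.toSubalgebra,
      IsClosed (E : Set A.toStarSubalgebra.toSubalgebra) ∧
      Nonempty (E ≃L[ℂ] lp (fun _ : ℕ => ℂ) ⊤) ∧
      ∃ c : ℝ, 0 < c ∧ ∀ x ∈ E, c * ‖x‖ ≤ ‖T x‖ := by
  have : IsClosed (A.toStarSubalgebra : Set (H →L[ℂ] H)) := A.isClosed_toStarSubalgebra
  let e : A.toStarSubalgebra →ₗᵢ[ℂ] A.toStarSubalgebra.toSubalgebra :=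
    { toFun := fun x => ⟨x.1, x.2⟩
      map_add' := fun _ _ => rfl
      map_smul' := fun _ _ => rfl
      norm_map' := fun _ => rfl }
  have hT' : ¬ IsWeaklyCompactOperator (T ∘L e.toContinuousLinearMap) := by
    refine fun h => hT ?_
    have himage : (T ∘L e.toContinuousLinearMap) '' Metric.closedBall 0 1 =
        T '' Metric.closedBall 0 1 := by
      refine Set.Subset.antisymm ?_ ?_
      · rintro _ ⟨x, hx, rfl⟩
        exact ⟨e x, by simpa using hx, rfl⟩
      · rintro _ ⟨x, hx, rfl⟩
        refine ⟨⟨x.1, x.2⟩, ?_, rfl⟩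
        rw [mem_closedBall_zero_iff] at hx ⊢
        exact hx
    rw [IsWeaklyCompactOperator] at h ⊢
    rwa [himage] at h
  obtain ⟨θ, hθ, u, v, huv, hu, hv⟩ := exists_two_sided_summable_of_cstarAlgebra hT'
  have hnorm : ∀ x : A.toStarSubalgebra, ‖(x : H →L[ℂ] H)‖ = ‖x‖ := fun _ => rfl
  obtain ⟨S, hS, hcomm⟩ := exists_clm_single_eq_mul (C := 2)
    (u := fun i => (u i : H →L[ℂ] H)) (v := fun i => (v i : H →L[ℂ] H))
    (fun n => by
      have h := (hnorm _).trans_le (hu n)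
      push_cast at h
      exact h)
    (fun n => by
      have h := (hnorm _).trans_le (hv n)
      push_cast at h
      exact h)
  have hSA : ∀ t, S t ∈ A := fun t => VonNeumannAlgebra.mem_of_forall_commute fun b hb =>
    hcomm t b fun j => hb _ (u j * v j).2
  let S' : lp (fun _ : ℕ => ℂ) ⊤ →L[ℂ] A.toStarSubalgebra.toSubalgebra :=
    S.codRestrict (Subalgebra.toSubmodule A.toStarSubalgebra.toSubalgebra) hSA
  have hS' : ∀ j, S' (lp.single ⊤ j 1) = e (u j * v j) := fun j => Subtype.ext (hS j)
  obtain ⟨J, hJ⟩ := exists_isometry_bounded_below (R := T ∘L S') hθ fun j => by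
    rw [ContinuousLinearMap.comp_apply, hS']
    exact huv j
  exact exists_closed_subspace_of_bounded_below (U := S' ∘L J.toContinuousLinearMap)
    (half_pos hθ) hJ
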